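/- arXiv:1404.6421 — 17 statements merged into one kernel-verified Lean document; each statement's English description precedes it below -/
import Mathlib

section
/- Let G be a self-adjoint operator on a finite-dimensional complex inner product space V, with spectral decomposition G = \sum_i G_i P_i where the G_i are the distinct real eigenvalues of G and the P_i are the orthogonal projections onto the corresponding eigenspaces (so the P_i are pairwise orthogonal and sum to the identity). Then for every linear operator \rho on V, the time average (1/T) \int_0^T e^{-itG} \rho \, e^{itG} \, dt converges, as T \to \infty, to the dephased operator \sum_i P_i \rho P_i. -/
open scoped Topology

theorem scalar_avg (a : ℝ) :
    Filter.Tendsto (fun T : ℝ => ((T : ℂ))⁻¹ * ∫ t in (0 : ℝ)..T, Complex.exp ((Complex.I * a) * t))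
      Filter.atTop (𝓝 (if a = 0 then 1 else 0)) := by
  split_ifs with h
  · subst h
    refine tendsto_const_nhds.congr' ?_
    filter_upwards [Filter.eventually_gt_atTop 0] with T hT
    have : (T : ℂ) ≠ 0 := by exact_mod_cast hT.ne'
    simp [this]
  · have hc : Complex.I * (a : ℂ) ≠ 0 := by simp [h]
    have hz : Filter.Tendsto (fun T : ℝ => T⁻¹ * (2 / |a|)) Filter.atTop (𝓝 0) := by
      simpa using tendsto_inv_atTop_zero.mul_const (2 / |a|)
    refine squeeze_zero_norm' ?_ hz
    filter_upwards [Filter.eventually_gt_atTop 0] with T hT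
    rw [integral_exp_mul_complex hc, norm_mul, norm_div, norm_inv, Complex.norm_real,
      Real.norm_of_nonneg hT.le]
    have h1 : ‖Complex.I * (a : ℂ)‖ = |a| := by simp
    have h2 : ‖Complex.exp (Complex.I * a * T) - Complex.exp (Complex.I * a * (0 : ℝ))‖ ≤ 2 := by
      refine (norm_sub_le _ _).trans ?_
      have : Complex.I * a * T = ((a * T : ℝ) : ℂ) * Complex.I := by push_cast; ring
      rw [this, Complex.norm_exp_ofReal_mul_I]
      norm_num
    rw [h1]
    gcongr

theorem exp_spectral {V : Type*} [NormedAddCommGroup V] [InnerProductSpace ℂ V]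
    [FiniteDimensional ℂ V] {ι : Type*} [Fintype ι] (P : ι → V →L[ℂ] V)
    (hPidem : ∀ i, P i * P i = P i)
    (hPorth : ∀ i j, i ≠ j → P i * P j = 0)
    (hPsum : ∑ i, P i = 1) (f : ι → ℂ) :
    NormedSpace.exp (∑ i, f i • P i) = ∑ i, Complex.exp (f i) • P i := by
  classical
  have : CompleteSpace V := FiniteDimensional.complete ℂ V
  let φ : (ι → ℂ) →+* (V →L[ℂ] V) :=
    { toFun := fun f => ∑ i, f i • P i
      map_one' := by simpa using hPsum
      map_zero' := by simp
      map_add' := fun f g => by simp [add_smul, Finset.sum_add_distrib]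
      map_mul' := fun f g => by
        rw [Finset.sum_mul_sum]
        refine Finset.sum_congr rfl fun i _ => ?_
        rw [Finset.sum_eq_single i]
        · rw [smul_mul_smul_comm, hPidem]; rfl
        · intro j _ hj
          rw [smul_mul_smul_comm, hPorth i j hj.symm, smul_zero]
        · simp }
  have hφ : Continuous φ := by
    change Continuous fun f : ι → ℂ => ∑ i, f i • P i
    fun_prop
  letI : Algebra ℚ (V →L[ℂ] V) := Algebra.compHom (V →L[ℂ] V) (algebraMap ℚ ℂ)
  have h := NormedSpace.map_exp φ hφ f
  change ∑ i, (NormedSpace.exp f) i • P i = NormedSpace.exp (∑ i, f i • P i) at h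
  rw [← h]
  refine Finset.sum_congr rfl fun i _ => ?_
  rw [Pi.coe_exp, Complex.exp_eq_exp_ℂ]



/-- Let `G` be a self-adjoint operator on a finite-dimensional complex
inner product space with spectral decomposition `G = ∑_i G_i P_i`, where the `G_i` are
the distinct real eigenvalues and the `P_i` are the corresponding orthogonal spectral
projections (pairwise orthogonal, summing to the identity).  Then for every operator
`ρ`, the time average `(1/T) ∫₀ᵀ e^{-itG} ρ e^{itG} dt` converges, as `T → ∞`, to the
dephased operator `∑_i P_i ρ P_i`. -/
theorem gtwirl_time_average_tendsto_dephasing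
    {V : Type*} [NormedAddCommGroup V] [InnerProductSpace ℂ V] [FiniteDimensional ℂ V]
    {ι : Type*} [Fintype ι] (P : ι → V →L[ℂ] V)
    (hPsa : ∀ i, IsSelfAdjoint (P i))
    (hPidem : ∀ i, P i * P i = P i)
    (hPorth : ∀ i j, i ≠ j → P i * P j = 0)
    (hPsum : ∑ i, P i = 1)
    (Gval : ι → ℝ) (hGval : Function.Injective Gval)
    (G : V →L[ℂ] V) (hG : G = ∑ i, (Gval i : ℂ) • P i)
    (ρ : V →L[ℂ] V) :
    Filter.Tendsto
      (fun T : ℝ => ((T : ℂ))⁻¹ •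
        ∫ t in (0 : ℝ)..T,
          NormedSpace.exp ((-(Complex.I * (t : ℂ))) • G) * ρ *
            NormedSpace.exp ((Complex.I * (t : ℂ)) • G))
      Filter.atTop (𝓝 (∑ i, P i * ρ * P i)) := by
  classical
  have : CompleteSpace V := FiniteDimensional.complete ℂ V
  have hexp : ∀ c : ℂ, NormedSpace.exp (c • G) = ∑ i, Complex.exp (c * Gval i) • P i := by
    intro c
    rw [← exp_spectral P hPidem hPorth hPsum, hG, Finset.smul_sum]
    simp only [smul_smul]
  have hint : ∀ t : ℝ, NormedSpace.exp ((-(Complex.I * (t : ℂ))) • G) * ρ *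
      NormedSpace.exp ((Complex.I * (t : ℂ)) • G) =
      ∑ i, ∑ j, Complex.exp ((Complex.I * ((Gval j - Gval i : ℝ) : ℂ)) * t) •
        (P i * ρ * P j) := by
    intro t
    rw [hexp, hexp, Finset.sum_mul, Finset.sum_mul_sum]
    refine Finset.sum_congr rfl fun i _ => Finset.sum_congr rfl fun j _ => ?_
    rw [smul_mul_assoc, smul_mul_smul_comm, ← Complex.exp_add]
    congr 2
    push_cast
    ring
  have hlim : ∑ i, P i * ρ * P i = ∑ i, ∑ j,
      (if Gval j - Gval i = 0 then (1 : ℂ) else 0) • (P i * ρ * P j) := by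
    refine Finset.sum_congr rfl fun i _ => ?_
    rw [Finset.sum_eq_single i]
    · simp
    · intro j _ hj
      have : Gval j - Gval i ≠ 0 := sub_ne_zero.2 (hGval.ne hj)
      simp [this]
    · simp
  rw [hlim]
  have key : Filter.Tendsto (fun T : ℝ => ∑ i, ∑ j,
      (((T : ℂ))⁻¹ * ∫ t in (0 : ℝ)..T,
        Complex.exp ((Complex.I * ((Gval j - Gval i : ℝ) : ℂ)) * t)) • (P i * ρ * P j))
      Filter.atTop (𝓝 (∑ i, ∑ j,
      (if Gval j - Gval i = 0 then (1 : ℂ) else 0) • (P i * ρ * P j))) :=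
    tendsto_finsetSum _ fun i _ => tendsto_finsetSum _ fun j _ =>
      (scalar_avg (Gval j - Gval i)).smul_const _
  refine key.congr fun T => ?_
  simp only [hint]
  rw [intervalIntegral.integral_finsetSum, Finset.smul_sum]
  · refine Finset.sum_congr rfl fun i _ => ?_
    rw [intervalIntegral.integral_finsetSum, Finset.smul_sum]
    · refine Finset.sum_congr rfl fun j _ => ?_
      rw [intervalIntegral.integral_smul_const, smul_smul]
    · intro j _
      exact Continuous.intervalIntegrable (by fun_prop) _ _
  · intro i _
    exact Continuous.intervalIntegrable (by fun_prop) _ _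
end

section
/- With the notation of the dephasing setup, the quantum Fisher information loss is nonnegative and at most the pure-state quantum Fisher information: 0 \le l \le H. Equivalently, \sum_{i : p_i \ne 0} (\mathrm{Im}\langle \psi, P_i \partial\psi \rangle)^2 / p_i \ge |\langle \psi, \partial\psi \rangle|^2. -/
/-- In the dephasing setup, the quantum Fisher information loss
`l = H - H_B` satisfies `0 ≤ l ≤ H`; equivalently,
`∑_i (Im⟨ψ, P_i ∂ψ⟩)² / p_i ≥ |⟨ψ, ∂ψ⟩|²`.
(Sums with `p i = 0` contribute `0`, by the convention `x / 0 = 0`, matching the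
restriction of the sum to indices with `p i ≠ 0`.) -/
theorem qfi_loss_nonneg_and_le
    {V : Type*} [NormedAddCommGroup V] [InnerProductSpace ℂ V] [FiniteDimensional ℂ V]
    {ι : Type*} [Fintype ι] (P : ι → V →L[ℂ] V)
    (hPsa : ∀ i, IsSelfAdjoint (P i))
    (hPidem : ∀ i, P i * P i = P i)
    (hPorth : ∀ i j, i ≠ j → P i * P j = 0)
    (hPsum : ∑ i, P i = 1)
    (ψ dψ : V) (hψ : ‖ψ‖ = 1)
    (hre : (inner ℂ ψ dψ : ℂ).re = 0)
    (p : ι → ℝ) (hp : ∀ i, p i = (inner ℂ ψ (P i ψ) : ℂ).re)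
    (H HB : ℝ)
    (hH : H = 4 * ((inner ℂ dψ dψ : ℂ).re - ‖(inner ℂ ψ dψ : ℂ)‖ ^ 2))
    (hHB : HB = 4 * (inner ℂ dψ dψ : ℂ).re
        - 4 * ∑ i, (inner ℂ ψ (P i dψ) : ℂ).im ^ 2 / p i) :
    (0 ≤ H - HB ∧ H - HB ≤ H) ∧
      ‖(inner ℂ ψ dψ : ℂ)‖ ^ 2 ≤ ∑ i, (inner ℂ ψ (P i dψ) : ℂ).im ^ 2 / p i := by
  have hmove : ∀ i (x y : V), inner ℂ x (P i y) = inner ℂ (P i x) (P i y) := by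
    intro i x y
    have h1 : P i (P i y) = P i y := by
      have := congrArg (fun T : V →L[ℂ] V => T y) (hPidem i)
      simpa using this
    have h2 := (ContinuousLinearMap.isSelfAdjoint_iff_isSymmetric.mp (hPsa i)) x (P i y)
    simp only [ContinuousLinearMap.coe_coe] at h2
    rw [h2, h1]
  have hnorm : ∀ i (x : V), (inner ℂ x (P i x) : ℂ).re = ‖P i x‖ ^ 2 := by
    intro i x
    rw [hmove]
    exact inner_self_eq_norm_sq (𝕜 := ℂ) (P i x)
  have hsum : ∀ x y : V, inner ℂ x y = ∑ i, inner ℂ x (P i y) := by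
    intro x y
    rw [← inner_sum]
    have := congrArg (fun T : V →L[ℂ] V => T y) hPsum
    simp only [ContinuousLinearMap.sum_apply, ContinuousLinearMap.one_apply] at this
    rw [this]
  have hp' : ∀ i, p i = ‖P i ψ‖ ^ 2 := fun i => by rw [hp, hnorm]
  have hp0 : ∀ i, 0 ≤ p i := fun i => by rw [hp']; positivity
  have hpsum : ∑ i, p i = 1 := by
    have h := congrArg Complex.re (hsum ψ ψ)
    rw [Complex.re_sum] at h
    have h3 : (inner ℂ ψ ψ : ℂ).re = ‖ψ‖ ^ 2 := inner_self_eq_norm_sq (𝕜 := ℂ) ψ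
    rw [h3, hψ] at h
    simp only [← hp] at h
    linarith
  have hb : ∀ i, (inner ℂ ψ (P i dψ) : ℂ).im ^ 2 ≤ p i * ‖P i dψ‖ ^ 2 := by
    intro i
    rw [hp', hmove, ← mul_pow, ← sq_abs]
    exact pow_le_pow_left₀ (abs_nonneg _)
      ((Complex.abs_im_le_norm _).trans (norm_inner_le_norm _ _)) 2
  have hlow : ‖(inner ℂ ψ dψ : ℂ)‖ ^ 2 ≤ ∑ i, (inner ℂ ψ (P i dψ) : ℂ).im ^ 2 / p i := by
    have e : ‖(inner ℂ ψ dψ : ℂ)‖ ^ 2 = (∑ i, (inner ℂ ψ (P i dψ) : ℂ).im) ^ 2 := by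
      rw [← Complex.im_sum, ← hsum, Complex.sq_norm, Complex.normSq_apply, hre]
      ring
    rw [e]
    have := Finset.sum_sq_le_sum_mul_sum_of_sq_eq_mul Finset.univ
      (r := fun i => (inner ℂ ψ (P i dψ) : ℂ).im)
      (f := fun i => (inner ℂ ψ (P i dψ) : ℂ).im ^ 2 / p i) (g := p)
      (fun i _ => div_nonneg (sq_nonneg _) (hp0 i)) (fun i _ => hp0 i)
      (fun i _ => by
        by_cases h : p i = 0
        · have := hb i
          rw [h, zero_mul] at this
          simp only [h, mul_zero]
          exact le_antisymm this (sq_nonneg _)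
        · field_simp)
    rwa [hpsum, mul_one] at this
  have hup : ∑ i, (inner ℂ ψ (P i dψ) : ℂ).im ^ 2 / p i ≤ (inner ℂ dψ dψ : ℂ).re := by
    rw [hsum dψ dψ, Complex.re_sum]
    refine Finset.sum_le_sum fun i _ => ?_
    rw [hnorm]
    exact div_le_of_le_mul₀ (hp0 i) (sq_nonneg _) (by linarith [hb i])
  refine ⟨⟨?_, ?_⟩, hlow⟩ <;> linarith
end

section
/- With the notation of the dephasing setup, the quantum Fisher information loss vanishes, l = 0, if and only if there exists a real number c such that for every index i, \mathrm{Im}\langle \psi, P_i \partial\psi \rangle = c \, p_i; moreover, when this condition holds, necessarily c = \mathrm{Im}\langle \psi, \partial\psi \rangle. -/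
/-- In the dephasing setup, the quantum Fisher information loss
vanishes, `l = H - H_B = 0`, iff there is a real number `c` with
`Im⟨ψ, P_i ∂ψ⟩ = c * p_i` for all `i`; moreover any such `c` necessarily equals
`Im⟨ψ, ∂ψ⟩`.  (Sums with `p i = 0` contribute `0`, by the convention `x / 0 = 0`,
matching the restriction of the sum to indices with `p i ≠ 0`.) -/
theorem qfi_loss_eq_zero_iff
    {V : Type*} [NormedAddCommGroup V] [InnerProductSpace ℂ V] [FiniteDimensional ℂ V]
    {ι : Type*} [Fintype ι] (P : ι → V →L[ℂ] V)
    (hPsa : ∀ i, IsSelfAdjoint (P i))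
    (hPidem : ∀ i, P i * P i = P i)
    (hPorth : ∀ i j, i ≠ j → P i * P j = 0)
    (hPsum : ∑ i, P i = 1)
    (ψ dψ : V) (hψ : ‖ψ‖ = 1)
    (hre : (inner ℂ ψ dψ : ℂ).re = 0)
    (p : ι → ℝ) (hp : ∀ i, p i = (inner ℂ ψ (P i ψ) : ℂ).re)
    (H HB : ℝ)
    (hH : H = 4 * ((inner ℂ dψ dψ : ℂ).re - ‖(inner ℂ ψ dψ : ℂ)‖ ^ 2))
    (hHB : HB = 4 * (inner ℂ dψ dψ : ℂ).re
        - 4 * ∑ i, (inner ℂ ψ (P i dψ) : ℂ).im ^ 2 / p i) :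
    (H - HB = 0 ↔ ∃ c : ℝ, ∀ i, (inner ℂ ψ (P i dψ) : ℂ).im = c * p i) ∧
      (∀ c : ℝ, (∀ i, (inner ℂ ψ (P i dψ) : ℂ).im = c * p i) →
        c = (inner ℂ ψ dψ : ℂ).im) := by
  have hmove : ∀ i (x : V), (inner ℂ ψ (P i x) : ℂ) = inner ℂ (P i ψ) x := fun i x => by
    have h := (hPsa i).isSymmetric ψ x
    simpa using h.symm
  have hpn : ∀ i, p i = ‖P i ψ‖ ^ 2 := fun i => by
    have h1 : P i ψ = P i (P i ψ) := by
      conv_lhs => rw [← hPidem i]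
      rfl
    rw [hp i, h1, hmove i, ← h1, inner_self_eq_norm_sq_to_K]
    norm_cast
  have hp0 : ∀ i, 0 ≤ p i := fun i => by rw [hpn i]; positivity
  have ha0 : ∀ i, p i = 0 → (inner ℂ ψ (P i dψ) : ℂ).im = 0 := fun i h => by
    rw [hpn i] at h
    have h2 : P i ψ = 0 := by simpa using h
    rw [hmove i, h2]
    simp
  have hsum : ∀ x : V, ∑ i, (inner ℂ ψ (P i x) : ℂ) = inner ℂ ψ x := fun x => by
    rw [← inner_sum, ← ContinuousLinearMap.sum_apply, hPsum]
    rfl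
  have hsa : ∑ i, (inner ℂ ψ (P i dψ) : ℂ).im = (inner ℂ ψ dψ : ℂ).im := by
    rw [← Complex.im_sum, hsum]
  have hsp : ∑ i, p i = 1 := by
    simp_rw [hp]
    rw [← Complex.re_sum, hsum, inner_self_eq_norm_sq_to_K, hψ]
    simp
  have hn : ‖(inner ℂ ψ dψ : ℂ)‖ ^ 2 = (inner ℂ ψ dψ : ℂ).im ^ 2 := by
    rw [Complex.sq_norm, Complex.normSq_apply, hre]
    ring
  have huniq : ∀ c : ℝ, (∀ i, (inner ℂ ψ (P i dψ) : ℂ).im = c * p i) →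
      c = (inner ℂ ψ dψ : ℂ).im := fun c hc => by
    rw [← hsa, Finset.sum_congr rfl (fun i _ => hc i), ← Finset.mul_sum, hsp, mul_one]
  rw [hn] at hH
  generalize (inner ℂ ψ dψ : ℂ).im = A at *
  generalize (inner ℂ dψ dψ : ℂ).re = D at *
  have hkey : H - HB = 4 * ∑ i, ((inner ℂ ψ (P i dψ) : ℂ).im - A * p i) ^ 2 / p i := by
    have h1 : ∀ i, ((inner ℂ ψ (P i dψ) : ℂ).im - A * p i) ^ 2 / p i =
        (inner ℂ ψ (P i dψ) : ℂ).im ^ 2 / p i - 2 * A * (inner ℂ ψ (P i dψ) : ℂ).im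
          + A ^ 2 * p i := fun i => by
      by_cases h : p i = 0
      · simp [h, ha0 i h]
      · field_simp
        ring
    rw [Finset.sum_congr rfl (fun i _ => h1 i), Finset.sum_add_distrib, Finset.sum_sub_distrib,
      ← Finset.mul_sum, ← Finset.mul_sum, hsa, hsp, hH, hHB]
    ring
  refine ⟨⟨fun h => ⟨A, fun i => ?_⟩, ?_⟩, huniq⟩
  · have h0 : ∑ i, ((inner ℂ ψ (P i dψ) : ℂ).im - A * p i) ^ 2 / p i = 0 := by linarith
    rw [Finset.sum_eq_zero_iff_of_nonneg
      (fun i _ => div_nonneg (sq_nonneg _) (hp0 i))] at h0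
    have h1 := h0 i (Finset.mem_univ i)
    rcases div_eq_zero_iff.mp h1 with h2 | h2
    · have h3 := pow_eq_zero_iff (two_ne_zero) |>.mp h2
      linarith
    · rw [ha0 i h2, h2, mul_zero]
  · rintro ⟨c, hc⟩
    have hcA := huniq c hc
    rw [hkey, Finset.sum_eq_zero, mul_zero]
    intro i _
    rw [hc i, hcA]
    simp
end

section
/- With the notation of the dephasing setup, define \widetilde{\partial\psi} := \sum_{i : p_i \ne 0} (\mathrm{Im}\langle \psi, P_i \partial\psi \rangle / p_i) \, P_i \psi. Then the quantum Fisher information loss satisfies l = 4\langle \widetilde{\partial\psi}, \widetilde{\partial\psi} \rangle - 4|\langle \psi, \widetilde{\partial\psi} \rangle|^2, and moreover \langle \psi, \widetilde{\partial\psi} \rangle = \mathrm{Im}\langle \psi, \partial\psi \rangle, so that |\langle \psi, \widetilde{\partial\psi} \rangle| = |\langle \psi, \partial\psi \rangle|. -/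
/-- In the dephasing setup, with
`tdψ := ∑_i (Im⟨ψ, P_i ∂ψ⟩ / p_i) • P_i ψ` (terms with `p i = 0` vanish, by the
convention `x / 0 = 0`), the quantum Fisher information loss satisfies
`l = 4⟨tdψ, tdψ⟩ - 4|⟨ψ, tdψ⟩|²`, and `⟨ψ, tdψ⟩ = Im⟨ψ, ∂ψ⟩`, hence
`|⟨ψ, tdψ⟩| = |⟨ψ, ∂ψ⟩|`. -/
theorem qfi_loss_eq_tilde_form
    {V : Type*} [NormedAddCommGroup V] [InnerProductSpace ℂ V] [FiniteDimensional ℂ V]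
    {ι : Type*} [Fintype ι] (P : ι → V →L[ℂ] V)
    (hPsa : ∀ i, IsSelfAdjoint (P i))
    (hPidem : ∀ i, P i * P i = P i)
    (hPorth : ∀ i j, i ≠ j → P i * P j = 0)
    (hPsum : ∑ i, P i = 1)
    (ψ dψ : V) (hψ : ‖ψ‖ = 1)
    (hre : (inner ℂ ψ dψ : ℂ).re = 0)
    (p : ι → ℝ) (hp : ∀ i, p i = (inner ℂ ψ (P i ψ) : ℂ).re)
    (H HB : ℝ)
    (hH : H = 4 * ((inner ℂ dψ dψ : ℂ).re - ‖(inner ℂ ψ dψ : ℂ)‖ ^ 2))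
    (hHB : HB = 4 * (inner ℂ dψ dψ : ℂ).re
        - 4 * ∑ i, (inner ℂ ψ (P i dψ) : ℂ).im ^ 2 / p i)
    (tdψ : V)
    (htdψ : tdψ = ∑ i, (((inner ℂ ψ (P i dψ) : ℂ).im / p i : ℝ) : ℂ) • P i ψ) :
    H - HB = 4 * (inner ℂ tdψ tdψ : ℂ).re - 4 * ‖(inner ℂ ψ tdψ : ℂ)‖ ^ 2 ∧
      (inner ℂ ψ tdψ : ℂ) = (((inner ℂ ψ dψ : ℂ).im : ℝ) : ℂ) ∧
      ‖(inner ℂ ψ tdψ : ℂ)‖ = ‖(inner ℂ ψ dψ : ℂ)‖ := by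
  haveI : CompleteSpace V := FiniteDimensional.complete ℂ V
  have hsym : ∀ i x y, (inner ℂ (P i x) y : ℂ) = inner ℂ x (P i y) :=
    fun i x y => (hPsa i).isSymmetric x y
  have hidem : ∀ i x, P i (P i x) = P i x := fun i x => by
    have := congrArg (fun T : V →L[ℂ] V => T x) (hPidem i)
    simpa using this
  have horth : ∀ i j x, i ≠ j → P i (P j x) = 0 := fun i j x h => by
    have := congrArg (fun T : V →L[ℂ] V => T x) (hPorth i j h)
    simpa using this
  have hnorm : ∀ i, (inner ℂ ψ (P i ψ) : ℂ) = ((‖P i ψ‖ ^ 2 : ℝ) : ℂ) := fun i => by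
    rw [← hidem i ψ, ← hsym, inner_self_eq_norm_sq_to_K, hidem]
    push_cast
    rfl
  have hpn : ∀ i, p i = ‖P i ψ‖ ^ 2 := fun i => by
    rw [hp, hnorm, Complex.ofReal_re]
  have hpc : ∀ i, (inner ℂ ψ (P i ψ) : ℂ) = (p i : ℂ) := fun i => by
    rw [hnorm, hpn]
  have hz : ∀ i, p i = 0 → (inner ℂ ψ (P i dψ) : ℂ).im = 0 := fun i h => by
    have h0 : P i ψ = 0 := by
      rw [hpn] at h
      simpa using h
    rw [← hsym, h0]
    simp
  have hsumv : ∀ x, ∑ i, P i x = x := fun x => by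
    have := congrArg (fun T : V →L[ℂ] V => T x) hPsum
    simpa using this
  have h2 : (inner ℂ ψ tdψ : ℂ) = (((inner ℂ ψ dψ : ℂ).im : ℝ) : ℂ) := by
    rw [htdψ, inner_sum]
    conv_rhs => rw [← hsumv dψ, inner_sum, Complex.im_sum, Complex.ofReal_sum]
    refine Finset.sum_congr rfl fun i _ => ?_
    rw [inner_smul_right, hpc, ← Complex.ofReal_mul]
    congr 1
    by_cases h : p i = 0
    · rw [hz i h, h]
      simp
    · field_simp
  have h3 : ‖(inner ℂ ψ tdψ : ℂ)‖ = ‖(inner ℂ ψ dψ : ℂ)‖ := by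
    rw [h2, Complex.norm_real, Real.norm_eq_abs, Complex.abs_im_eq_norm.mpr hre]
  have hPt : ∀ i, P i tdψ = (((inner ℂ ψ (P i dψ) : ℂ).im / p i : ℝ) : ℂ) • P i ψ := fun i => by
    rw [htdψ, map_sum, Finset.sum_eq_single i]
    · rw [map_smul, hidem]
    · intro j _ hj
      rw [map_smul, horth i j ψ hj.symm, smul_zero]
    · simp
  have h4 : (inner ℂ tdψ tdψ : ℂ).re = ∑ i, (inner ℂ ψ (P i dψ) : ℂ).im ^ 2 / p i := by
    conv_lhs => rw [← hsumv tdψ, inner_sum, Complex.re_sum]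
    refine Finset.sum_congr rfl fun i _ => ?_
    rw [hsumv, ← hidem i tdψ, ← hsym, hPt, inner_smul_left, inner_smul_right, hsym, hidem, hpc,
      Complex.conj_ofReal, ← Complex.ofReal_mul, ← Complex.ofReal_mul, Complex.ofReal_re]
    by_cases h : p i = 0
    · rw [h]
      simp
    · field_simp
  refine ⟨?_, h2, h3⟩
  rw [h3, h4, hH, hHB]
  ring
end

section
/- With the notation of the dephasing setup, define \widetilde{\partial\psi} := \sum_{i : p_i \ne 0} (\mathrm{Im}\langle \psi, P_i \partial\psi \rangle / p_i) \, P_i \psi. Then the following are equivalent: (a) the loss is maximal, l = H; (b) \langle \widetilde{\partial\psi}, \widetilde{\partial\psi} \rangle = \langle \partial\psi, \partial\psi \rangle; (c) for every i, \mathrm{Re}\langle \psi, P_i \partial\psi \rangle = 0, and \partial\psi lies in the linear span of the vectors \{ P_i \psi : p_i \ne 0 \}. -/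
/-- In the dephasing setup, with
`tdψ := ∑_i (Im⟨ψ, P_i ∂ψ⟩ / p_i) • P_i ψ` (terms with `p i = 0` vanish, by the
convention `x / 0 = 0`), the following are equivalent:
(a) the loss is maximal, `l = H`;
(b) `⟨tdψ, tdψ⟩ = ⟨∂ψ, ∂ψ⟩`;
(c) `Re⟨ψ, P_i ∂ψ⟩ = 0` for all `i`, and `∂ψ` lies in the span of
    `{P_i ψ : p_i ≠ 0}`. -/
theorem qfi_max_loss_iff
    {V : Type*} [NormedAddCommGroup V] [InnerProductSpace ℂ V] [FiniteDimensional ℂ V]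
    {ι : Type*} [Fintype ι] (P : ι → V →L[ℂ] V)
    (hPsa : ∀ i, IsSelfAdjoint (P i))
    (hPidem : ∀ i, P i * P i = P i)
    (hPorth : ∀ i j, i ≠ j → P i * P j = 0)
    (hPsum : ∑ i, P i = 1)
    (ψ dψ : V) (hψ : ‖ψ‖ = 1)
    (hre : (inner ℂ ψ dψ : ℂ).re = 0)
    (p : ι → ℝ) (hp : ∀ i, p i = (inner ℂ ψ (P i ψ) : ℂ).re)
    (H HB : ℝ)
    (hH : H = 4 * ((inner ℂ dψ dψ : ℂ).re - ‖(inner ℂ ψ dψ : ℂ)‖ ^ 2))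
    (hHB : HB = 4 * (inner ℂ dψ dψ : ℂ).re
        - 4 * ∑ i, (inner ℂ ψ (P i dψ) : ℂ).im ^ 2 / p i)
    (tdψ : V)
    (htdψ : tdψ = ∑ i, (((inner ℂ ψ (P i dψ) : ℂ).im / p i : ℝ) : ℂ) • P i ψ) :
    (H - HB = H ↔ (inner ℂ tdψ tdψ : ℂ).re = (inner ℂ dψ dψ : ℂ).re) ∧
      (H - HB = H ↔
        ((∀ i, (inner ℂ ψ (P i dψ) : ℂ).re = 0) ∧
          dψ ∈ Submodule.span ℂ {v : V | ∃ i, p i ≠ 0 ∧ v = P i ψ})) := by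
  classical
  have hsym : ∀ i x y, (inner ℂ (P i x) y : ℂ) = inner ℂ x (P i y) := by
    intro i x y
    have h := ContinuousLinearMap.adjoint_inner_left (P i) y x
    rw [← ContinuousLinearMap.star_eq_adjoint, (hPsa i).star_eq] at h
    exact h
  have hid : ∀ i x, P i (P i x) = P i x := fun i x => by
    have h := congrArg (fun T : V →L[ℂ] V => T x) (hPidem i)
    simpa using h
  have hor : ∀ i j x, i ≠ j → P i (P j x) = 0 := fun i j x hij => by
    have h := congrArg (fun T : V →L[ℂ] V => T x) (hPorth i j hij)
    simpa using h
  have hpc : ∀ i, (inner ℂ ψ (P i ψ) : ℂ) = (p i : ℂ) := by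
    intro i
    rw [hp i, ← hid i ψ, ← hsym, inner_self_eq_norm_sq_to_K]
    norm_cast
  have hij : ∀ i j, (inner ℂ ψ (P i (P j ψ)) : ℂ) = if i = j then (p i : ℂ) else 0 := by
    intro i j
    split_ifs with h
    · subst h
      rw [hid, hpc]
    · rw [hor i j ψ h, inner_zero_right]
  set m : ι → ℝ := fun i => (inner ℂ ψ (P i dψ) : ℂ).im with hm
  -- component of the tilde vector
  have hcomp : ∀ i, (inner ℂ ψ (P i tdψ) : ℂ) = ((m i / p i * p i : ℝ) : ℂ) := by
    intro i
    rw [htdψ, map_sum, inner_sum]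
    simp only [map_smul, inner_smul_right, hij]
    simp [hm]
  have hleft : ∀ v, (inner ℂ tdψ v : ℂ) = ∑ i, ((m i / p i : ℝ) : ℂ) * inner ℂ ψ (P i v) := by
    intro v
    conv_lhs => rw [htdψ]
    rw [sum_inner]
    refine Finset.sum_congr rfl fun i _ => ?_
    rw [inner_smul_left, hsym, Complex.conj_ofReal]
  have h1 : (inner ℂ tdψ tdψ : ℂ).re = ∑ i, m i ^ 2 / p i := by
    rw [hleft, Complex.re_sum]
    refine Finset.sum_congr rfl fun i _ => ?_
    rw [hcomp, ← Complex.ofReal_mul, Complex.ofReal_re]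
    by_cases h : p i = 0
    · simp [h]
    · field_simp
  have h2 : (inner ℂ tdψ dψ : ℂ).im = ∑ i, m i ^ 2 / p i := by
    rw [hleft, Complex.im_sum]
    refine Finset.sum_congr rfl fun i _ => ?_
    rw [Complex.im_ofReal_mul]
    change m i / p i * m i = _
    ring
  have h3 : ‖dψ - Complex.I • tdψ‖ ^ 2 = (inner ℂ dψ dψ : ℂ).re - ∑ i, m i ^ 2 / p i := by
    have e1 := norm_sub_sq (𝕜 := ℂ) (Complex.I • tdψ) dψ
    rw [norm_sub_rev, e1, inner_smul_left, norm_smul, Complex.norm_I, one_mul]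
    have e2 := inner_self_eq_norm_sq (𝕜 := ℂ) tdψ
    have e3 := inner_self_eq_norm_sq (𝕜 := ℂ) dψ
    simp only [RCLike.re_to_complex] at *
    rw [← e2, ← e3, h1]
    simp [h2]
    ring
  have ha : H - HB = H ↔ ∑ i, m i ^ 2 / p i = (inner ℂ dψ dψ : ℂ).re := by
    rw [hHB]
    constructor <;> intro h <;> linarith
  have hb : H - HB = H ↔ dψ = Complex.I • tdψ := by
    rw [ha]
    constructor
    · intro h
      rw [h, sub_self] at h3
      exact sub_eq_zero.mp (norm_eq_zero.mp (pow_eq_zero_iff two_ne_zero |>.mp h3))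
    · intro h
      rw [← sub_eq_zero] at h
      rw [h] at h3
      simp only [norm_zero] at h3
      linarith
  refine ⟨by rw [ha, h1], ?_⟩
  rw [hb]
  constructor
  · intro h
    refine ⟨fun i => ?_, ?_⟩
    · rw [h, map_smul, inner_smul_right, hcomp, Complex.re_mul_ofReal]
      simp
    · rw [h, htdψ]
      refine Submodule.smul_mem _ _ (Submodule.sum_mem _ fun i _ => ?_)
      by_cases h0 : p i = 0
      · simp [h0]
      · exact Submodule.smul_mem _ _ (Submodule.subset_span ⟨i, h0, rfl⟩)
  · rintro ⟨hr, hs⟩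
    have key : ∀ v ∈ Submodule.span ℂ {v : V | ∃ i, p i ≠ 0 ∧ v = P i ψ},
        v = ∑ i, ((inner ℂ ψ (P i v) : ℂ) / (p i : ℂ)) • P i ψ := by
      intro v hv
      induction hv using Submodule.span_induction with
      | mem x hx =>
        obtain ⟨j, hj, rfl⟩ := hx
        simp only [hij]
        rw [Finset.sum_eq_single j]
        · have : (p j : ℂ) ≠ 0 := by exact_mod_cast hj
          simp [this]
        · intro i _ h
          simp [h]
        · simp
      | zero => simp
      | add x y _ _ hx hy =>
        simp only [map_add, inner_add_right, add_div, add_smul, Finset.sum_add_distrib]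
        rw [← hx, ← hy]
      | smul a x _ hx =>
        simp only [map_smul, inner_smul_right, mul_div_assoc, mul_smul, ← Finset.smul_sum]
        rw [← hx]
    conv_lhs => rw [key dψ hs]
    rw [htdψ, Finset.smul_sum]
    refine Finset.sum_congr rfl fun i _ => ?_
    rw [smul_smul]
    congr 1
    have : (inner ℂ ψ (P i dψ) : ℂ) = Complex.I * (m i : ℂ) := by
      apply Complex.ext <;> simp [hr i, hm]
    rw [Complex.ofReal_div, ← mul_div_assoc, ← this]
end

section
/- With the notation of the generator setup, suppose additionally that K commutes with every projection P_i. Let \psi_0 \in V be a unit vector and for each real \lambda set \psi_\lambda := e^{-iK\lambda}\psi_0. Then for every \lambda, the dephased quantum Fisher information of \psi_\lambda equals 4\langle \psi_0, K^2 \psi_0 \rangle - 4 \sum_{i : \langle \psi_0, P_i \psi_0 \rangle \ne 0} (\mathrm{Re}\langle \psi_0, P_i K \psi_0 \rangle)^2 / \langle \psi_0, P_i \psi_0 \rangle; in particular it is independent of \lambda. -/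
/-- In the generator setup, if `K` commutes with every projection
`P_i`, then for a unit vector `ψ₀` and `ψ_λ := e^{-iKλ}ψ₀`, the dephased quantum
Fisher information of `ψ_λ` equals
`4⟨ψ₀, K²ψ₀⟩ - 4 ∑_i (Re⟨ψ₀, P_i K ψ₀⟩)² / ⟨ψ₀, P_i ψ₀⟩`,
independently of `λ`.  (Sums with vanishing denominator contribute `0`, by the
convention `x / 0 = 0`, matching the restriction to indices with nonzero
probability.) -/
theorem dephased_qfi_commuting_lambda_independent
    {V : Type*} [NormedAddCommGroup V] [InnerProductSpace ℂ V] [FiniteDimensional ℂ V]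
    {ι : Type*} [Fintype ι] (P : ι → V →L[ℂ] V)
    (hPsa : ∀ i, IsSelfAdjoint (P i))
    (hPidem : ∀ i, P i * P i = P i)
    (hPorth : ∀ i j, i ≠ j → P i * P j = 0)
    (hPsum : ∑ i, P i = 1)
    (K : V →L[ℂ] V) (hK : IsSelfAdjoint K)
    (hcomm : ∀ i, K * P i = P i * K)
    (ψ0 : V) (hψ0 : ‖ψ0‖ = 1)
    (lam : ℝ) (ψ : V)
    (hψ : ψ = NormedSpace.exp ((-(Complex.I * (lam : ℂ))) • K) ψ0)
    (dψ : V) (hdψ : dψ = (-Complex.I) • K ψ)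
    (p : ι → ℝ) (hp : ∀ i, p i = (inner ℂ ψ (P i ψ) : ℂ).re)
    (HB : ℝ)
    (hHB : HB = 4 * (inner ℂ dψ dψ : ℂ).re
        - 4 * ∑ i, (inner ℂ ψ (P i dψ) : ℂ).im ^ 2 / p i) :
    HB = 4 * (inner ℂ ψ0 ((K * K) ψ0) : ℂ).re
      - 4 * ∑ i, (inner ℂ ψ0 ((P i * K) ψ0) : ℂ).re ^ 2 / (inner ℂ ψ0 (P i ψ0) : ℂ).re := by
  have key : ∀ T : V →L[ℂ] V, Commute K T → inner ℂ ψ (T ψ) = inner ℂ ψ0 (T ψ0) := by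
    intro T hT
    set A : V →L[ℂ] V := (-(Complex.I * (lam : ℂ))) • K with hA
    have hsA : star A = -A := by
      rw [hA, star_smul, hK.star_eq]
      simp
    letI : NormedAlgebra ℚ (V →L[ℂ] V) := NormedAlgebra.restrictScalars ℚ ℂ (V →L[ℂ] V)
    have hU : star (NormedSpace.exp A) * NormedSpace.exp A = 1 := by
      rw [NormedSpace.star_exp, hsA,
        ← NormedSpace.exp_add_of_commute ((Commute.refl A).neg_left)]
      simp
    have hAT : Commute A T := hT.smul_left _
    have hUT : Commute (NormedSpace.exp A) T := hAT.exp_left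
    have h2 : star (NormedSpace.exp A) * (T * NormedSpace.exp A) = T := by
      rw [← hUT.eq, ← mul_assoc, hU, one_mul]
    have h3 := congrArg (fun S : V →L[ℂ] V => inner ℂ ψ0 (S ψ0)) h2
    simp only [mul_apply_eq_comp, ContinuousLinearMap.star_eq_adjoint,
      ContinuousLinearMap.adjoint_inner_right] at h3
    rw [hψ]
    exact h3
  have hKs : ∀ x y : V, inner ℂ (K x) y = inner ℂ x (K y) := by
    intro x y
    rw [← ContinuousLinearMap.adjoint_inner_right, ← ContinuousLinearMap.star_eq_adjoint,
      hK.star_eq]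
  have h1 : (inner ℂ dψ dψ : ℂ) = inner ℂ ψ0 ((K * K) ψ0) := by
    rw [← key (K * K) ((Commute.refl K).mul_right (Commute.refl K)), hdψ, inner_smul_left,
      inner_smul_right, mul_apply_eq_comp, hKs, ← mul_assoc]
    simp
  have h2 : ∀ i, (inner ℂ ψ (P i dψ) : ℂ).im = -(inner ℂ ψ0 ((P i * K) ψ0) : ℂ).re := by
    intro i
    have hc : Commute K (P i) := hcomm i
    rw [← key (P i * K) (hc.mul_right (Commute.refl K)), hdψ, map_smul, inner_smul_right]
    simp
  rw [hHB, h1]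
  simp only [h2, hp, key _ (hcomm _), neg_sq]
end

section
/- With the notation of the generator setup, the quantum Fisher information loss vanishes, l = 0, if and only if for every index i the covariance of P_i and K vanishes: \tfrac{1}{2}\langle \psi, (P_i K + K P_i)\psi \rangle = \langle \psi, K\psi \rangle \, \langle \psi, P_i \psi \rangle. -/
/-- In the generator setup, the quantum Fisher information loss
vanishes, `l = H - H_B = 0`, iff for every index `i` the covariance of `P_i` and `K`
vanishes: `½⟨ψ, (P_i K + K P_i)ψ⟩ = ⟨ψ, Kψ⟩⟨ψ, P_i ψ⟩`.  (Sums with `p i = 0`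
contribute `0`, by the convention `x / 0 = 0`.) -/
theorem qfi_loss_zero_iff_cov_proj
    {V : Type*} [NormedAddCommGroup V] [InnerProductSpace ℂ V] [FiniteDimensional ℂ V]
    {ι : Type*} [Fintype ι] (P : ι → V →L[ℂ] V)
    (hPsa : ∀ i, IsSelfAdjoint (P i))
    (hPidem : ∀ i, P i * P i = P i)
    (hPorth : ∀ i j, i ≠ j → P i * P j = 0)
    (hPsum : ∑ i, P i = 1)
    (K : V →L[ℂ] V) (hK : IsSelfAdjoint K)
    (ψ : V) (hψ : ‖ψ‖ = 1)
    (dψ : V) (hdψ : dψ = (-Complex.I) • K ψ)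
    (p : ι → ℝ) (hp : ∀ i, p i = (inner ℂ ψ (P i ψ) : ℂ).re)
    (H HB : ℝ)
    (hH : H = 4 * ((inner ℂ (K ψ) (K ψ) : ℂ).re - (inner ℂ ψ (K ψ) : ℂ).re ^ 2))
    (hHB : HB = 4 * (inner ℂ dψ dψ : ℂ).re
        - 4 * ∑ i, (inner ℂ ψ (P i dψ) : ℂ).im ^ 2 / p i) :
    H - HB = 0 ↔
      ∀ i, (1 / 2 : ℝ) * (inner ℂ ψ ((P i * K + K * P i) ψ) : ℂ).re
        = (inner ℂ ψ (K ψ) : ℂ).re * p i := by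
  have hPs : ∀ i (x y : V), inner ℂ (P i x) y = inner ℂ x (P i y) := fun i x y =>
    (ContinuousLinearMap.isSelfAdjoint_iff_isSymmetric.mp (hPsa i)) x y
  have hKs : ∀ (x y : V), inner ℂ (K x) y = inner ℂ x (K y) := fun x y =>
    (ContinuousLinearMap.isSelfAdjoint_iff_isSymmetric.mp hK) x y
  have hpn : ∀ i, p i = ‖P i ψ‖ ^ 2 := by
    intro i
    have h1 : P i ψ = P i (P i ψ) := by
      rw [← ContinuousLinearMap.mul_apply, hPidem]
    rw [hp, h1, ← hPs, ← inner_self_eq_norm_sq (𝕜 := ℂ), ← h1]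
    rfl
  have hsum : ∀ x : V, ∑ i, (inner ℂ ψ (P i x) : ℂ).re = (inner ℂ ψ x : ℂ).re := by
    intro x
    rw [← Complex.re_sum, ← inner_sum, ← ContinuousLinearMap.sum_apply, hPsum]
    rfl
  have hp1 : ∑ i, p i = 1 := by
    simp_rw [hp]
    rw [hsum, inner_self_eq_norm_sq_to_K, hψ]
    simp
  have ha0 : ∀ i, p i = 0 → (inner ℂ ψ (P i (K ψ)) : ℂ).re = 0 := by
    intro i h
    rw [hpn] at h
    have : P i ψ = 0 := by simpa using h
    rw [← hPs, this]; simp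
  have hcov : ∀ i, (1 / 2 : ℝ) * (inner ℂ ψ ((P i * K + K * P i) ψ) : ℂ).re
      = (inner ℂ ψ (P i (K ψ)) : ℂ).re := by
    intro i
    have h2 : (inner ℂ ψ (K (P i ψ)) : ℂ).re = (inner ℂ ψ (P i (K ψ)) : ℂ).re := by
      rw [← hKs, ← hPs]
      exact inner_re_symm (𝕜 := ℂ) _ _
    rw [ContinuousLinearMap.add_apply, ContinuousLinearMap.mul_apply,
      ContinuousLinearMap.mul_apply, inner_add_right, Complex.add_re, h2]
    ring
  have him : ∀ i, (inner ℂ ψ (P i dψ) : ℂ).im = -(inner ℂ ψ (P i (K ψ)) : ℂ).re := by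
    intro i
    rw [hdψ, map_smul, inner_smul_right]
    simp
  have hdd : (inner ℂ dψ dψ : ℂ) = inner ℂ (K ψ) (K ψ) := by
    rw [hdψ, inner_smul_left, inner_smul_right, ← mul_assoc]
    simp
  have hm := hsum (K ψ)
  simp_rw [hcov]
  simp_rw [him] at hHB
  rw [hdd] at hHB
  generalize (inner ℂ ψ (K ψ) : ℂ).re = m at *
  generalize ha : (fun i => (inner ℂ ψ (P i (K ψ)) : ℂ).re) = a at *
  have ha' : ∀ i, (inner ℂ ψ (P i (K ψ)) : ℂ).re = a i := fun i => by rw [← ha]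
  simp_rw [ha'] at *
  have hpos : ∀ i, 0 ≤ p i := fun i => by rw [hpn]; positivity
  have key : H - HB = 4 * ∑ i, (a i - m * p i) ^ 2 / p i := by
    have : ∀ i, (a i - m * p i) ^ 2 / p i = (-a i) ^ 2 / p i - 2 * m * a i + m ^ 2 * p i := by
      intro i
      by_cases h : p i = 0
      · simp [h, ha0 i h]
      · field_simp
        ring
    simp_rw [this]
    rw [Finset.sum_add_distrib, Finset.sum_sub_distrib, ← Finset.mul_sum, ← Finset.mul_sum,
      hm, hp1, hH, hHB]
    ring
  rw [key]
  have hnn : ∀ i ∈ Finset.univ, 0 ≤ (a i - m * p i) ^ 2 / p i := fun i _ =>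
    div_nonneg (sq_nonneg _) (hpos i)
  constructor
  · intro h i
    have h0 : ∑ i, (a i - m * p i) ^ 2 / p i = 0 := by linarith
    have h1 := (Finset.sum_eq_zero_iff_of_nonneg hnn).mp h0 i (Finset.mem_univ i)
    by_cases hpi : p i = 0
    · rw [hpi, ha0 i hpi]; simp
    · rcases div_eq_zero_iff.mp h1 with h2 | h2
      · exact sub_eq_zero.mp (pow_eq_zero_iff two_ne_zero |>.mp h2)
      · exact absurd h2 hpi
  · intro h
    simp [h]
end

section
/- With the notation of the generator setup, the loss is maximal, l = H, if and only if both of the following hold: (a) for every index i, \langle \psi, (P_i K - K P_i)\psi \rangle = 0; and (b) the vector K\psi lies in the linear span of the vectors \{ P_i \psi : p_i \ne 0 \} (equivalently, \langle \phi, K\psi \rangle = 0 for every \phi orthogonal to all the P_i\psi). -/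
/-- In the generator setup, the loss is maximal, `l = H`, iff
(a) `⟨ψ, (P_i K - K P_i)ψ⟩ = 0` for every `i`, and
(b) `Kψ` lies in the linear span of `{P_i ψ : p_i ≠ 0}`.
(Sums with `p i = 0` contribute `0`, by the convention `x / 0 = 0`.) -/
theorem qfi_max_loss_iff_commutator_and_span
    {V : Type*} [NormedAddCommGroup V] [InnerProductSpace ℂ V] [FiniteDimensional ℂ V]
    {ι : Type*} [Fintype ι] (P : ι → V →L[ℂ] V)
    (hPsa : ∀ i, IsSelfAdjoint (P i))
    (hPidem : ∀ i, P i * P i = P i)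
    (hPorth : ∀ i j, i ≠ j → P i * P j = 0)
    (hPsum : ∑ i, P i = 1)
    (K : V →L[ℂ] V) (hK : IsSelfAdjoint K)
    (ψ : V) (hψ : ‖ψ‖ = 1)
    (dψ : V) (hdψ : dψ = (-Complex.I) • K ψ)
    (p : ι → ℝ) (hp : ∀ i, p i = (inner ℂ ψ (P i ψ) : ℂ).re)
    (H HB : ℝ)
    (hH : H = 4 * ((inner ℂ (K ψ) (K ψ) : ℂ).re - (inner ℂ ψ (K ψ) : ℂ).re ^ 2))
    (hHB : HB = 4 * (inner ℂ dψ dψ : ℂ).re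
        - 4 * ∑ i, (inner ℂ ψ (P i dψ) : ℂ).im ^ 2 / p i) :
    H - HB = H ↔
      ((∀ i, (inner ℂ ψ ((P i * K - K * P i) ψ) : ℂ) = 0) ∧
        K ψ ∈ Submodule.span ℂ {v : V | ∃ i, p i ≠ 0 ∧ v = P i ψ}) := by
  classical
  have hsym : ∀ (T : V →L[ℂ] V), IsSelfAdjoint T → ∀ x y : V,
      (inner ℂ (T x) y : ℂ) = inner ℂ x (T y) := fun T hT x y => hT.isSymmetric x y
  set c : ι → ℂ := fun i => inner ℂ (P i ψ) (K ψ) with hc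
  have hPP : ∀ i, (inner ℂ (P i ψ) (P i ψ) : ℂ) = (p i : ℂ) := by
    intro i
    have h1 : (inner ℂ ψ (P i ψ) : ℂ) = inner ℂ (P i ψ) (P i ψ) := by
      rw [hsym _ (hPsa i), ← mul_apply_eq_comp, hPidem]
    rw [hp i, h1]
    exact (inner_self_ofReal_re (𝕜 := ℂ) (P i ψ)).symm
  have hPPo : ∀ i j, i ≠ j → (inner ℂ (P i ψ) (P j ψ) : ℂ) = 0 := by
    intro i j hij
    rw [hsym _ (hPsa i), ← mul_apply_eq_comp, hPorth i j hij]
    simp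
  have hc0 : ∀ i, p i = 0 → c i = 0 := by
    intro i hi
    have h := hPP i
    rw [hi, Complex.ofReal_zero, inner_self_eq_zero] at h
    simp [hc, h]
  set a : ι → ℝ := fun i => (c i).re / p i with ha
  set w : V := ∑ i, (a i : ℂ) • P i ψ with hw
  have hPw : ∀ i, (inner ℂ (P i ψ) w : ℂ) = ((c i).re : ℂ) := by
    intro i
    rw [hw, inner_sum, Finset.sum_eq_single i]
    · rw [inner_smul_right, hPP, ← Complex.ofReal_mul]
      by_cases h : p i = 0
      · simp [h, hc0 i h]
      · simp [ha, div_mul_cancel₀ _ h]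
    · intro j _ hj
      rw [inner_smul_right, hPPo i j hj.symm, mul_zero]
    · simp
  have hwx : ∀ x : V, (inner ℂ w x : ℂ).re = ∑ i, a i * (inner ℂ (P i ψ) x : ℂ).re := by
    intro x
    rw [hw, sum_inner, Complex.re_sum]
    refine Finset.sum_congr rfl fun i _ => ?_
    rw [inner_smul_left, Complex.conj_ofReal, Complex.re_ofReal_mul]
  have hwK : (inner ℂ w (K ψ) : ℂ).re = ∑ i, a i * (c i).re := hwx _
  have hww : (inner ℂ w w : ℂ).re = ∑ i, a i * (c i).re := by
    rw [hwx]
    simp [hPw]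
  have hKw : (inner ℂ (K ψ) w : ℂ).re = ∑ i, a i * (c i).re := by
    rw [← hwK, ← inner_conj_symm, Complex.conj_re]
  have hS : ∑ i, (inner ℂ ψ (P i dψ) : ℂ).im ^ 2 / p i = ∑ i, a i * (c i).re := by
    refine Finset.sum_congr rfl fun i _ => ?_
    have h : (inner ℂ ψ (P i dψ) : ℂ) = -Complex.I * c i := by
      rw [← hsym _ (hPsa i), hdψ, inner_smul_right]
    rw [h, ha]
    simp
    ring
  have hd : (inner ℂ dψ dψ : ℂ) = inner ℂ (K ψ) (K ψ) := by
    rw [hdψ, inner_smul_left, inner_smul_right, ← mul_assoc]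
    simp
  have hHB2 : HB = 4 * (inner ℂ (K ψ - w) (K ψ - w) : ℂ).re := by
    rw [hHB, hS, hd, inner_sub_left, inner_sub_right, inner_sub_right]
    simp only [Complex.sub_re]
    rw [hww, hwK, hKw]
    ring
  have hcomm : ∀ i, (inner ℂ ψ ((P i * K - K * P i) ψ) : ℂ) = c i - (starRingEnd ℂ) (c i) := by
    intro i
    simp only [sub_apply, mul_apply_eq_comp, inner_sub_right]
    rw [← hsym _ (hPsa i) ψ (K ψ), ← hsym _ hK ψ (P i ψ)]
    simp only [hc, inner_conj_symm]
  have hmain : H - HB = H ↔ K ψ = w := by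
    have h0 : (inner ℂ (K ψ - w) (K ψ - w) : ℂ).re = ‖K ψ - w‖ ^ 2 :=
      inner_self_eq_norm_sq (𝕜 := ℂ) _
    rw [h0] at hHB2
    rw [sub_eq_self, hHB2, ← sub_eq_zero (a := K ψ)]
    simp
  have hwspan : w ∈ Submodule.span ℂ {v : V | ∃ i, p i ≠ 0 ∧ v = P i ψ} := by
    refine Submodule.sum_mem _ fun i _ => ?_
    by_cases h : p i = 0
    · simp [ha, h]
    · exact Submodule.smul_mem _ _ (Submodule.subset_span ⟨i, h, rfl⟩)
  rw [hmain]
  constructor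
  · intro h
    refine ⟨fun i => ?_, h ▸ hwspan⟩
    have h2 : c i = ((c i).re : ℂ) := by
      rw [← hPw i, ← h]
    rw [hcomm, h2, Complex.conj_ofReal, sub_self]
  · rintro ⟨h1, h2⟩
    have hort : ∀ x ∈ Submodule.span ℂ {v : V | ∃ i, p i ≠ 0 ∧ v = P i ψ},
        (inner ℂ x (K ψ - w) : ℂ) = 0 := by
      intro x hx
      induction hx using Submodule.span_induction with
      | mem x hx =>
        obtain ⟨i, -, rfl⟩ := hx
        have h3 := h1 i
        rw [hcomm, sub_eq_zero] at h3
        rw [inner_sub_right, hPw, Complex.conj_eq_iff_re.mp h3.symm, sub_self]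
      | zero => simp
      | add x y _ _ hx hy => rw [inner_add_left, hx, hy, add_zero]
      | smul t x _ hx => rw [inner_smul_left, hx, mul_zero]
    exact sub_eq_zero.mp (inner_self_eq_zero.mp (hort _ (Submodule.sub_mem _ h2 hwspan)))
end

section
/- With the notation of the generator setup, let G := \sum_i G_i P_i where the G_i are real numbers. If the quantum Fisher information loss vanishes, l = 0, then the covariance of G and K with respect to \psi vanishes: \tfrac{1}{2}\langle \psi, (GK + KG)\psi \rangle = \langle \psi, G\psi \rangle \, \langle \psi, K\psi \rangle. -/
/-- In the generator setup, with `G := ∑_i G_i P_i` for real numbers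
`G_i`: if the quantum Fisher information loss vanishes, `l = H - H_B = 0`, then the
covariance of `G` and `K` with respect to `ψ` vanishes:
`½⟨ψ, (GK + KG)ψ⟩ = ⟨ψ, Gψ⟩⟨ψ, Kψ⟩`.
(Sums with `p i = 0` contribute `0`, by the convention `x / 0 = 0`.) -/
theorem qfi_loss_zero_implies_cov_GK_zero
    {V : Type*} [NormedAddCommGroup V] [InnerProductSpace ℂ V] [FiniteDimensional ℂ V]
    {ι : Type*} [Fintype ι] (P : ι → V →L[ℂ] V)
    (hPsa : ∀ i, IsSelfAdjoint (P i))
    (hPidem : ∀ i, P i * P i = P i)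
    (hPorth : ∀ i j, i ≠ j → P i * P j = 0)
    (hPsum : ∑ i, P i = 1)
    (K : V →L[ℂ] V) (hK : IsSelfAdjoint K)
    (ψ : V) (hψ : ‖ψ‖ = 1)
    (dψ : V) (hdψ : dψ = (-Complex.I) • K ψ)
    (p : ι → ℝ) (hp : ∀ i, p i = (inner ℂ ψ (P i ψ) : ℂ).re)
    (H HB : ℝ)
    (hH : H = 4 * ((inner ℂ (K ψ) (K ψ) : ℂ).re - (inner ℂ ψ (K ψ) : ℂ).re ^ 2))
    (hHB : HB = 4 * (inner ℂ dψ dψ : ℂ).re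
        - 4 * ∑ i, (inner ℂ ψ (P i dψ) : ℂ).im ^ 2 / p i)
    (Gval : ι → ℝ) (G : V →L[ℂ] V)
    (hG : G = ∑ i, (Gval i : ℂ) • P i) :
    H - HB = 0 →
      (1 / 2 : ℝ) * (inner ℂ ψ ((G * K + K * G) ψ) : ℂ).re
        = (inner ℂ ψ (G ψ) : ℂ).re * (inner ℂ ψ (K ψ) : ℂ).re := by
  intro hl
  have hPs : ∀ i x y, inner ℂ (P i x) y = inner ℂ x (P i y) := fun i =>
    ContinuousLinearMap.isSelfAdjoint_iff_isSymmetric.mp (hPsa i)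
  have hKs : ∀ x y, inner ℂ (K x) y = inner ℂ x (K y) :=
    ContinuousLinearMap.isSelfAdjoint_iff_isSymmetric.mp hK
  have hpn : ∀ i, p i = ‖P i ψ‖ ^ 2 := by
    intro i
    have h1 : P i (P i ψ) = P i ψ := by
      have := congrArg (fun T : V →L[ℂ] V => T ψ) (hPidem i)
      simpa using this
    rw [hp i, ← h1, ← hPs, inner_self_eq_norm_sq_to_K, h1]
    norm_cast
  have hp0 : ∀ i, 0 ≤ p i := fun i => by rw [hpn i]; positivity
  have hsum : ∀ x, ∑ i, P i x = x := by
    intro x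
    have := congrArg (fun T : V →L[ℂ] V => T x) hPsum
    simpa using this
  obtain ⟨a, ha⟩ : ∃ a : ι → ℝ, ∀ i, a i = (inner ℂ ψ (P i (K ψ)) : ℂ).re := ⟨_, fun _ => rfl⟩
  obtain ⟨k, hk⟩ : ∃ k : ℝ, k = (inner ℂ ψ (K ψ) : ℂ).re := ⟨_, rfl⟩
  have hsa : ∑ i, a i = k := by
    simp only [ha]
    rw [← Complex.re_sum, ← inner_sum, hsum, hk]
  have hsp : ∑ i, p i = 1 := by
    simp only [hp]
    rw [← Complex.re_sum, ← inner_sum, hsum, inner_self_eq_norm_sq_to_K, hψ]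
    norm_num
  have ha0 : ∀ i, p i = 0 → a i = 0 := by
    intro i h
    rw [hpn i] at h
    have h2 : P i ψ = 0 := by simpa using h
    rw [ha i, ← hPs, h2]
    simp
  have him : ∀ i, (inner ℂ ψ (P i dψ) : ℂ).im ^ 2 = a i ^ 2 := by
    intro i
    rw [hdψ, map_smul, inner_smul_right, ha i]
    simp
  have hdd : (inner ℂ dψ dψ : ℂ) = inner ℂ (K ψ) (K ψ) := by
    rw [hdψ, inner_smul_right, inner_smul_left, ← mul_assoc]
    simp
  have hloss : ∑ i, a i ^ 2 / p i = k ^ 2 := by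
    simp only [him, hdd] at hHB
    rw [← hk] at hH
    linarith
  have hterm : ∀ i, (a i - p i * k) ^ 2 / p i = a i ^ 2 / p i - 2 * k * a i + k ^ 2 * p i := by
    intro i
    by_cases h : p i = 0
    · simp [h, ha0 i h]
    · field_simp
      ring
  have hzero : ∑ i, (a i - p i * k) ^ 2 / p i = 0 := by
    simp only [hterm]
    rw [Finset.sum_add_distrib, Finset.sum_sub_distrib, ← Finset.mul_sum, ← Finset.mul_sum,
      hloss, hsa, hsp]
    ring
  have hak : ∀ i, a i = p i * k := by
    intro i
    by_cases h : p i = 0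
    · simp [h, ha0 i h]
    · have h3 := (Finset.sum_eq_zero_iff_of_nonneg
        (fun i _ => div_nonneg (sq_nonneg (a i - p i * k)) (hp0 i))).mp hzero i (Finset.mem_univ i)
      have h4 : a i - p i * k = 0 := by simpa [h] using h3
      linarith
  have hGx : ∀ x, G x = ∑ i, (Gval i : ℂ) • P i x := by
    intro x
    rw [hG]
    simp
  have hGs : ∀ x y, inner ℂ (G x) y = inner ℂ x (G y) := by
    intro x y
    rw [hGx, hGx, sum_inner, inner_sum]
    refine Finset.sum_congr rfl fun i _ => ?_
    rw [inner_smul_left, inner_smul_right, hPs, Complex.conj_ofReal]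
  have h1 : (inner ℂ ψ (G (K ψ)) : ℂ).re = ∑ i, Gval i * a i := by
    rw [hGx, inner_sum, Complex.re_sum]
    refine Finset.sum_congr rfl fun i _ => ?_
    rw [inner_smul_right, Complex.re_ofReal_mul, ha]
  have h2 : (inner ℂ ψ (G ψ) : ℂ).re = ∑ i, Gval i * p i := by
    rw [hGx, inner_sum, Complex.re_sum]
    refine Finset.sum_congr rfl fun i _ => ?_
    rw [inner_smul_right, Complex.re_ofReal_mul, hp]
  have h3 : (inner ℂ ψ (K (G ψ)) : ℂ).re = (inner ℂ ψ (G (K ψ)) : ℂ).re := by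
    rw [← hKs, ← hGs, ← inner_conj_symm, Complex.conj_re]
  have h4 : (G * K + K * G) ψ = G (K ψ) + K (G ψ) := rfl
  rw [h4, inner_add_right, Complex.add_re, h3, h1, h2, ← hk, Finset.sum_mul]
  have h5 : ∑ i, Gval i * a i = ∑ i, Gval i * p i * k :=
    Finset.sum_congr rfl fun i _ => by rw [hak i]; ring
  rw [h5]
  ring
end

section
/- With the notation of the generator setup, let G := \sum_i G_i P_i where the G_i are real numbers. If the loss is maximal, l = H, then the expectation of the commutator of G and K vanishes: \langle \psi, (GK - KG)\psi \rangle = 0. -/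
/-- In the generator setup, with `G := ∑_i G_i P_i` for real numbers
`G_i`: if the loss is maximal, `l = H`, then the expectation of the commutator of `G`
and `K` vanishes: `⟨ψ, (GK - KG)ψ⟩ = 0`.
(Sums with `p i = 0` contribute `0`, by the convention `x / 0 = 0`.) -/
theorem qfi_max_loss_implies_commutator_expectation_zero
    {V : Type*} [NormedAddCommGroup V] [InnerProductSpace ℂ V] [FiniteDimensional ℂ V]
    {ι : Type*} [Fintype ι] (P : ι → V →L[ℂ] V)
    (hPsa : ∀ i, IsSelfAdjoint (P i))
    (hPidem : ∀ i, P i * P i = P i)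
    (hPorth : ∀ i j, i ≠ j → P i * P j = 0)
    (hPsum : ∑ i, P i = 1)
    (K : V →L[ℂ] V) (hK : IsSelfAdjoint K)
    (ψ : V) (hψ : ‖ψ‖ = 1)
    (dψ : V) (hdψ : dψ = (-Complex.I) • K ψ)
    (p : ι → ℝ) (hp : ∀ i, p i = (inner ℂ ψ (P i ψ) : ℂ).re)
    (H HB : ℝ)
    (hH : H = 4 * ((inner ℂ (K ψ) (K ψ) : ℂ).re - (inner ℂ ψ (K ψ) : ℂ).re ^ 2))
    (hHB : HB = 4 * (inner ℂ dψ dψ : ℂ).re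
        - 4 * ∑ i, (inner ℂ ψ (P i dψ) : ℂ).im ^ 2 / p i)
    (Gval : ι → ℝ) (G : V →L[ℂ] V)
    (hG : G = ∑ i, (Gval i : ℂ) • P i) :
    H - HB = H → (inner ℂ ψ ((G * K - K * G) ψ) : ℂ) = 0 := by
  intro hl
  have hB : HB = 0 := by linarith
  have hsym : ∀ i x y, (inner ℂ (P i x) y : ℂ) = inner ℂ x (P i y) := fun i x y =>
    (ContinuousLinearMap.isSelfAdjoint_iff_isSymmetric.mp (hPsa i)) x y
  have hKsym : ∀ x y, (inner ℂ (K x) y : ℂ) = inner ℂ x (K y) := fun x y =>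
    (ContinuousLinearMap.isSelfAdjoint_iff_isSymmetric.mp hK) x y
  have hidem : ∀ i x, P i (P i x) = P i x := fun i x => by
    have := congrArg (fun T : V →L[ℂ] V => T x) (hPidem i)
    simpa using this
  have hin : ∀ i x y, (inner ℂ x (P i y) : ℂ) = inner ℂ (P i x) (P i y) := fun i x y => by
    rw [hsym, hidem]
  have hpn : ∀ i, p i = ‖P i ψ‖ ^ 2 := fun i => by
    rw [hp, hin, inner_self_eq_norm_sq_to_K]
    norm_cast
  have hsumd : (inner ℂ dψ dψ : ℂ).re = ∑ i, ‖P i dψ‖ ^ 2 := by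
    have h1 : dψ = ∑ i, P i dψ := by
      have := congrArg (fun T : V →L[ℂ] V => T dψ) hPsum
      simpa using this.symm
    conv_lhs => rw [h1]
    rw [← h1]
    conv_lhs => arg 1; arg 3; rw [h1]
    rw [inner_sum, Complex.re_sum]
    refine Finset.sum_congr rfl fun i _ => ?_
    rw [hin, inner_self_eq_norm_sq_to_K]
    norm_cast
  have hcs : ∀ i, (inner ℂ ψ (P i dψ) : ℂ).re ^ 2 + (inner ℂ ψ (P i dψ) : ℂ).im ^ 2
      ≤ p i * ‖P i dψ‖ ^ 2 := fun i => by
    have h := norm_inner_le_norm (𝕜 := ℂ) (P i ψ) (P i dψ)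
    have h2 := pow_le_pow_left₀ (norm_nonneg _) h 2
    rw [← hin, Complex.sq_norm, Complex.normSq_apply, mul_pow, ← hpn] at h2
    nlinarith
  have hp0 : ∀ i, 0 ≤ p i := fun i => by rw [hpn]; positivity
  have hle : ∀ i ∈ Finset.univ, (inner ℂ ψ (P i dψ) : ℂ).im ^ 2 / p i ≤ ‖P i dψ‖ ^ 2 :=
    fun i _ => by
      rcases (hp0 i).eq_or_lt with h | h
      · rw [← h, div_zero]; positivity
      · rw [div_le_iff₀ h]
        nlinarith [hcs i, sq_nonneg (inner ℂ ψ (P i dψ) : ℂ).re]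
  have heq := (Finset.sum_eq_sum_iff_of_le hle).mp (by rw [← hsumd]; linarith)
  have hre : ∀ i, (inner ℂ ψ (P i dψ) : ℂ).re = 0 := fun i => by
    have h := hcs i
    rcases (hp0 i).eq_or_lt with h0 | h0
    · rw [← h0] at h
      nlinarith [sq_nonneg (inner ℂ ψ (P i dψ) : ℂ).re, sq_nonneg (inner ℂ ψ (P i dψ) : ℂ).im]
    · have he := heq i (Finset.mem_univ i)
      rw [div_eq_iff h0.ne'] at he
      nlinarith [sq_nonneg (inner ℂ ψ (P i dψ) : ℂ).re]
  have him : ∀ i, (inner ℂ ψ (P i (K ψ)) : ℂ).im = 0 := fun i => by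
    have h := hre i
    rw [hdψ, map_smul, inner_smul_right] at h
    simpa using h
  have hcomm : ∀ i, (inner ℂ ψ (K (P i ψ)) : ℂ) = inner ℂ ψ (P i (K ψ)) := fun i => by
    rw [← hKsym, ← hsym, ← inner_conj_symm]
    exact Complex.conj_eq_iff_im.mpr (him i)
  have hGK : (inner ℂ ψ (G (K ψ)) : ℂ) = inner ℂ ψ (K (G ψ)) := by
    rw [hG]
    simp only [ContinuousLinearMap.sum_apply, ContinuousLinearMap.smul_apply, map_sum, map_smul,
      inner_sum, inner_smul_right, hcomm]
  simp [inner_sub_right, hGK]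
end

section
/- With the notation of the generator setup, the quantum Fisher information loss equals four times the sum of the squared covariances of the projections with the generator, weighted by inverse probabilities: l = 4 \sum_{i : p_i \ne 0} \mathrm{Cov}(P_i, K)^2 / p_i, where \mathrm{Cov}(P_i,K) := \tfrac{1}{2}\langle \psi, (P_i K + K P_i)\psi \rangle - \langle \psi, P_i\psi \rangle\langle \psi, K\psi \rangle. -/
/-- In the generator setup, the quantum Fisher information loss
equals `l = 4 ∑_i Cov(P_i, K)² / p_i`, where
`Cov(P_i, K) = ½⟨ψ, (P_i K + K P_i)ψ⟩ - ⟨ψ, P_i ψ⟩⟨ψ, Kψ⟩`.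
(Sums with `p i = 0` contribute `0`, by the convention `x / 0 = 0`.) -/
theorem qfi_loss_eq_sum_cov_sq
    {V : Type*} [NormedAddCommGroup V] [InnerProductSpace ℂ V] [FiniteDimensional ℂ V]
    {ι : Type*} [Fintype ι] (P : ι → V →L[ℂ] V)
    (hPsa : ∀ i, IsSelfAdjoint (P i))
    (hPidem : ∀ i, P i * P i = P i)
    (hPorth : ∀ i j, i ≠ j → P i * P j = 0)
    (hPsum : ∑ i, P i = 1)
    (K : V →L[ℂ] V) (hK : IsSelfAdjoint K)
    (ψ : V) (hψ : ‖ψ‖ = 1)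
    (dψ : V) (hdψ : dψ = (-Complex.I) • K ψ)
    (p : ι → ℝ) (hp : ∀ i, p i = (inner ℂ ψ (P i ψ) : ℂ).re)
    (H HB : ℝ)
    (hH : H = 4 * ((inner ℂ (K ψ) (K ψ) : ℂ).re - (inner ℂ ψ (K ψ) : ℂ).re ^ 2))
    (hHB : HB = 4 * (inner ℂ dψ dψ : ℂ).re
        - 4 * ∑ i, (inner ℂ ψ (P i dψ) : ℂ).im ^ 2 / p i)
    (Cov : ι → ℝ)
    (hCov : ∀ i, Cov i = (1 / 2 : ℝ) * (inner ℂ ψ ((P i * K + K * P i) ψ) : ℂ).re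
        - p i * (inner ℂ ψ (K ψ) : ℂ).re) :
    H - HB = 4 * ∑ i, Cov i ^ 2 / p i := by
  have hsymP : ∀ i x y, inner ℂ (P i x) y = (inner ℂ x (P i y) : ℂ) :=
    fun i x y => (hPsa i).isSymmetric x y
  have hsymK : ∀ x y, inner ℂ (K x) y = (inner ℂ x (K y) : ℂ) :=
    fun x y => hK.isSymmetric x y
  set k : ℝ := (inner ℂ ψ (K ψ) : ℂ).re with hk
  let a : ι → ℝ := fun i => (inner ℂ ψ (P i (K ψ)) : ℂ).re
  have hsum : ∀ x, ∑ i, (inner ℂ ψ (P i x) : ℂ).re = (inner ℂ ψ x : ℂ).re := by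
    intro x
    have h : ∑ i, P i x = x := by
      have := congrArg (fun T : V →L[ℂ] V => T x) hPsum
      simpa using this
    rw [← Complex.re_sum, ← inner_sum, h]
  have hsa : ∑ i, a i = k := hsum (K ψ)
  have hsp : ∑ i, p i = 1 := by
    simp only [hp]
    rw [hsum ψ, inner_self_eq_norm_sq_to_K, hψ]
    simp
  have him : ∀ i, (inner ℂ ψ (P i dψ) : ℂ).im = - a i := by
    intro i
    simp [hdψ, a, inner_smul_right, Complex.mul_im]
  have hdd : (inner ℂ dψ dψ : ℂ).re = (inner ℂ (K ψ) (K ψ) : ℂ).re := by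
    rw [hdψ, inner_smul_left, inner_smul_right, ← mul_assoc]
    simp
  have hc : ∀ i, Cov i = a i - p i * k := by
    intro i
    have h2 : (inner ℂ ψ (K (P i ψ)) : ℂ).re = a i := by
      rw [← hsymK, ← hsymP, ← inner_conj_symm, Complex.conj_re]
    rw [hCov]
    have h3 : (P i * K + K * P i) ψ = P i (K ψ) + K (P i ψ) := rfl
    rw [h3, inner_add_right, Complex.add_re, h2]
    change 1 / 2 * (a i + a i) - _ = _
    ring
  have ha0 : ∀ i, p i = 0 → a i = 0 := by
    intro i h0
    have hPP : P i (P i ψ) = P i ψ := by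
      have := congrArg (fun T : V →L[ℂ] V => T ψ) (hPidem i)
      simpa using this
    have h1 : (inner ℂ (P i ψ) (P i ψ) : ℂ).re = 0 := by
      rw [hsymP, hPP, ← hp, h0]
    have h2 : P i ψ = 0 := by
      have h3 : ‖P i ψ‖ ^ 2 = 0 := by
        rw [← h1]
        exact norm_sq_eq_re_inner (𝕜 := ℂ) (P i ψ)
      simpa using h3
    change (inner ℂ ψ (P i (K ψ)) : ℂ).re = 0
    rw [← hsymP, h2, inner_zero_left, Complex.zero_re]
  have hterm : ∀ i, Cov i ^ 2 / p i = a i ^ 2 / p i - 2 * k * a i + k ^ 2 * p i := by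
    intro i
    rw [hc]
    by_cases h0 : p i = 0
    · simp [h0, ha0 i h0]
    · field_simp
      ring
  simp only [hterm, Finset.sum_add_distrib, Finset.sum_sub_distrib, ← Finset.mul_sum, hsa, hsp]
  rw [hH, hHB, hdd]
  simp only [him, neg_sq]
  ring
end

section
/- (Theorem 2 of the paper.) With the notation of the generator setup, the dephased quantum Fisher information equals H_B = 4\,\mathrm{Var}(K) - 4 \sum_{i : p_i \ne 0} p_i \left( \mathrm{Cov}(P_i, K)/p_i \right)^2, where \mathrm{Var}(K) := \langle \psi, K^2\psi \rangle - \langle \psi, K\psi \rangle^2 and \mathrm{Cov}(P_i,K) := \tfrac{1}{2}\langle \psi, (P_i K + K P_i)\psi \rangle - \langle \psi, P_i\psi \rangle\langle \psi, K\psi \rangle. -/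
/-- Theorem 2 of the paper. In the generator setup, the dephased
quantum Fisher information equals
`H_B = 4 Var(K) - 4 ∑_i p_i (Cov(P_i, K)/p_i)²`, where
`Var(K) = ⟨ψ, K²ψ⟩ - ⟨ψ, Kψ⟩²` and
`Cov(P_i, K) = ½⟨ψ, (P_i K + K P_i)ψ⟩ - ⟨ψ, P_i ψ⟩⟨ψ, Kψ⟩`.
(Sums with `p i = 0` contribute `0`, by the convention `x / 0 = 0`.) -/
theorem dephased_qfi_var_cov_form
    {V : Type*} [NormedAddCommGroup V] [InnerProductSpace ℂ V] [FiniteDimensional ℂ V]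
    {ι : Type*} [Fintype ι] (P : ι → V →L[ℂ] V)
    (hPsa : ∀ i, IsSelfAdjoint (P i))
    (hPidem : ∀ i, P i * P i = P i)
    (hPorth : ∀ i j, i ≠ j → P i * P j = 0)
    (hPsum : ∑ i, P i = 1)
    (K : V →L[ℂ] V) (hK : IsSelfAdjoint K)
    (ψ : V) (hψ : ‖ψ‖ = 1)
    (dψ : V) (hdψ : dψ = (-Complex.I) • K ψ)
    (p : ι → ℝ) (hp : ∀ i, p i = (inner ℂ ψ (P i ψ) : ℂ).re)
    (HB : ℝ)
    (hHB : HB = 4 * (inner ℂ dψ dψ : ℂ).re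
        - 4 * ∑ i, (inner ℂ ψ (P i dψ) : ℂ).im ^ 2 / p i)
    (Cov : ι → ℝ)
    (hCov : ∀ i, Cov i = (1 / 2 : ℝ) * (inner ℂ ψ ((P i * K + K * P i) ψ) : ℂ).re
        - p i * (inner ℂ ψ (K ψ) : ℂ).re) :
    HB = 4 * ((inner ℂ ψ ((K * K) ψ) : ℂ).re - (inner ℂ ψ (K ψ) : ℂ).re ^ 2)
      - 4 * ∑ i, p i * (Cov i / p i) ^ 2 := by
  have hPs : ∀ i x y, inner ℂ (P i x) y = inner ℂ x (P i y) := fun i x y =>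
    (ContinuousLinearMap.isSelfAdjoint_iff_isSymmetric.mp (hPsa i)) x y
  have hKs : ∀ x y, inner ℂ (K x) y = inner ℂ x (K y) := fun x y =>
    (ContinuousLinearMap.isSelfAdjoint_iff_isSymmetric.mp hK) x y
  have hr : ∀ i, (inner ℂ ψ (P i dψ) : ℂ).im = -(inner ℂ ψ (P i (K ψ)) : ℂ).re := by
    intro i
    rw [hdψ, map_smul, inner_smul_right]
    simp
  have hkk : (inner ℂ dψ dψ : ℂ).re = (inner ℂ ψ ((K * K) ψ) : ℂ).re := by
    rw [hdψ, inner_smul_right, inner_smul_left, hKs]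
    simp
  have hC : ∀ i, Cov i = (inner ℂ ψ (P i (K ψ)) : ℂ).re
      - p i * (inner ℂ ψ (K ψ) : ℂ).re := by
    intro i
    have h2 : (inner ℂ ψ (K (P i ψ)) : ℂ).re = (inner ℂ ψ (P i (K ψ)) : ℂ).re := by
      rw [← hKs, ← hPs, ← inner_conj_symm, Complex.conj_re]
    rw [hCov i, ContinuousLinearMap.add_apply, ContinuousLinearMap.mul_apply,
      ContinuousLinearMap.mul_apply, inner_add_right, Complex.add_re, h2]
    ring
  have hz : ∀ i, p i = 0 → (inner ℂ ψ (P i (K ψ)) : ℂ).re = 0 := by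
    intro i hi
    have h1 : inner ℂ (P i ψ) (P i ψ) = inner ℂ ψ (P i ψ) := by
      rw [hPs, ← ContinuousLinearMap.mul_apply, hPidem]
    have h2 : P i ψ = 0 := by
      have h3 : (inner ℂ (P i ψ) (P i ψ) : ℂ).re = 0 := by rw [h1, ← hp, hi]
      have h4 := inner_self_eq_norm_sq (𝕜 := ℂ) (P i ψ)
      rw [← norm_eq_zero, ← sq_eq_zero_iff, ← h4]
      exact h3
    rw [← hPs, h2]
    simp
  have hsum : ∀ x, ∑ i, (inner ℂ ψ (P i x) : ℂ).re = (inner ℂ ψ x : ℂ).re := by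
    intro x
    rw [← Complex.re_sum, ← inner_sum, ← ContinuousLinearMap.sum_apply, hPsum]
    rfl
  have hp1 : ∑ i, p i = 1 := by
    simp_rw [hp]
    rw [hsum, inner_self_eq_norm_sq_to_K, hψ]
    simp
  have hterm : ∀ i, p i * (Cov i / p i) ^ 2 = (inner ℂ ψ (P i dψ) : ℂ).im ^ 2 / p i
      - 2 * (inner ℂ ψ (K ψ) : ℂ).re * (inner ℂ ψ (P i (K ψ)) : ℂ).re
      + (inner ℂ ψ (K ψ) : ℂ).re ^ 2 * p i := by
    intro i
    rw [hr, hC]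
    by_cases h : p i = 0
    · rw [hz i h, h]; simp
    · field_simp
      ring
  rw [hHB, hkk, Finset.sum_congr rfl (fun i _ => hterm i), Finset.sum_add_distrib,
    Finset.sum_sub_distrib, ← Finset.mul_sum, ← Finset.mul_sum, hsum, hp1]
  ring
end

section
/- With the notation of the generator setup, suppose additionally that K commutes with every projection P_i. Then: (a) for every i with p_i \ne 0, writing \psi_i := P_i\psi/\sqrt{p_i}, one has \mathrm{Cov}(P_i, K) = p_i \left( \langle \psi_i, K\psi_i \rangle - \langle \psi, K\psi \rangle \right); and (b) the dephased quantum Fisher information decomposes as H_B = 4 \sum_{i : p_i \ne 0} p_i \left( \langle \psi_i, K^2 \psi_i \rangle - \langle \psi_i, K\psi_i \rangle^2 \right), i.e. H_B is the p_i-weighted average of the pure-state quantum Fisher informations of the normalized projected states \psi_i. -/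
/-- In the generator setup, if `K` commutes with every projection
`P_i`, then with `ψ_i := P_i ψ / √p_i`:
(a) for every `i` with `p_i ≠ 0`, `Cov(P_i, K) = p_i (⟨ψ_i, Kψ_i⟩ - ⟨ψ, Kψ⟩)`; and
(b) `H_B = 4 ∑_i p_i (⟨ψ_i, K²ψ_i⟩ - ⟨ψ_i, Kψ_i⟩²)`, the `p_i`-weighted average of
the pure-state quantum Fisher informations of the normalized projected states.
(Sums with `p i = 0` contribute `0`, by the convention `x / 0 = 0` and since then
`P_i ψ = 0`.) -/
theorem dephased_qfi_commuting_decomposition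
    {V : Type*} [NormedAddCommGroup V] [InnerProductSpace ℂ V] [FiniteDimensional ℂ V]
    {ι : Type*} [Fintype ι] (P : ι → V →L[ℂ] V)
    (hPsa : ∀ i, IsSelfAdjoint (P i))
    (hPidem : ∀ i, P i * P i = P i)
    (hPorth : ∀ i j, i ≠ j → P i * P j = 0)
    (hPsum : ∑ i, P i = 1)
    (K : V →L[ℂ] V) (hK : IsSelfAdjoint K)
    (hcomm : ∀ i, K * P i = P i * K)
    (ψ : V) (hψ : ‖ψ‖ = 1)
    (dψ : V) (hdψ : dψ = (-Complex.I) • K ψ)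
    (p : ι → ℝ) (hp : ∀ i, p i = (inner ℂ ψ (P i ψ) : ℂ).re)
    (HB : ℝ)
    (hHB : HB = 4 * (inner ℂ dψ dψ : ℂ).re
        - 4 * ∑ i, (inner ℂ ψ (P i dψ) : ℂ).im ^ 2 / p i)
    (Cov : ι → ℝ)
    (hCov : ∀ i, Cov i = (1 / 2 : ℝ) * (inner ℂ ψ ((P i * K + K * P i) ψ) : ℂ).re
        - p i * (inner ℂ ψ (K ψ) : ℂ).re)
    (ψn : ι → V)
    (hψn : ∀ i, ψn i = (((Real.sqrt (p i))⁻¹ : ℝ) : ℂ) • P i ψ) :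
    (∀ i, p i ≠ 0 →
        Cov i = p i * ((inner ℂ (ψn i) (K (ψn i)) : ℂ).re - (inner ℂ ψ (K ψ) : ℂ).re)) ∧
      HB = 4 * ∑ i, p i *
        ((inner ℂ (ψn i) ((K * K) (ψn i)) : ℂ).re - (inner ℂ (ψn i) (K (ψn i)) : ℂ).re ^ 2) := by
  have : CompleteSpace V := FiniteDimensional.complete ℂ V
  have sP : ∀ i x y, (inner ℂ (P i x) y : ℂ) = inner ℂ x (P i y) := fun i x y =>
    (ContinuousLinearMap.isSelfAdjoint_iff_isSymmetric.mp (hPsa i)) x y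
  have sK : ∀ x y, (inner ℂ (K x) y : ℂ) = inner ℂ x (K y) := fun x y =>
    (ContinuousLinearMap.isSelfAdjoint_iff_isSymmetric.mp hK) x y
  have idem : ∀ i x, P i (P i x) = P i x := fun i x => by
    have := congrArg (fun T : V →L[ℂ] V => T x) (hPidem i)
    simpa using this
  have comm : ∀ i x, K (P i x) = P i (K x) := fun i x => by
    have := congrArg (fun T : V →L[ℂ] V => T x) (hcomm i)
    simpa using this
  have hsum : ∀ x, ∑ i, P i x = x := fun x => by
    have := congrArg (fun T : V →L[ℂ] V => T x) hPsum
    simpa using this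
  have hpn : ∀ i, p i = ‖P i ψ‖ ^ 2 := fun i => by
    rw [hp, ← idem, ← sP, idem]
    exact inner_self_eq_norm_sq (𝕜 := ℂ) (P i ψ)
  have hp0 : ∀ i, 0 ≤ p i := fun i => by rw [hpn]; positivity
  have hsq : ∀ i, (Real.sqrt (p i))⁻¹ * (Real.sqrt (p i))⁻¹ = (p i)⁻¹ := fun i => by
    rw [← mul_inv, Real.mul_self_sqrt (hp0 i)]
  have key : ∀ i (z w : V), P i z = P i w → ∀ c : ℝ,
      (inner ℂ ((c : ℂ) • P i ψ) ((c : ℂ) • P i z) : ℂ).re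
        = c * c * (inner ℂ ψ (P i w) : ℂ).re := fun i z w h c => by
    rw [inner_smul_left, inner_smul_right, h, sP, idem, Complex.conj_ofReal, ← mul_assoc,
      ← Complex.ofReal_mul, Complex.re_ofReal_mul]
  have h1 : ∀ i, (inner ℂ (ψn i) (K (ψn i)) : ℂ).re
      = (p i)⁻¹ * (inner ℂ ψ (P i (K ψ)) : ℂ).re := fun i => by
    rw [hψn, map_smul, comm, key i (K ψ) (K ψ) rfl, hsq]
  have h2 : ∀ i, (inner ℂ (ψn i) ((K * K) (ψn i)) : ℂ).re
      = (p i)⁻¹ * (inner ℂ ψ (P i (K (K ψ))) : ℂ).re := fun i => by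
    rw [hψn, map_smul, mul_apply_eq_comp, comm, comm, key i _ _ rfl, hsq]
  refine ⟨fun i hi => ?_, ?_⟩
  · rw [hCov, h1]
    have : (P i * K + K * P i) ψ = P i (K ψ) + P i (K ψ) := by
      simp [comm]
    rw [this, inner_add_right, Complex.add_re]
    field_simp
    ring
  · have hd : (inner ℂ dψ dψ : ℂ).re = ∑ i, (inner ℂ ψ (P i (K (K ψ))) : ℂ).re := by
      rw [← Complex.re_sum, ← inner_sum, hsum, ← sK, hdψ, inner_smul_left, inner_smul_right]
      simp [← mul_assoc]
    have him : ∀ i, (inner ℂ ψ (P i dψ) : ℂ).im ^ 2 = (inner ℂ ψ (P i (K ψ)) : ℂ).re ^ 2 :=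
      fun i => by
        rw [hdψ, map_smul, inner_smul_right]
        simp
    rw [hHB, hd, ← mul_sub, ← Finset.sum_sub_distrib]
    congr 1
    refine Finset.sum_congr rfl fun i _ => ?_
    rw [him, h1, h2]
    by_cases hi : p i = 0
    · have h0 : P i ψ = 0 := by
        have := hpn i
        rw [hi] at this
        simpa using this.symm
      rw [← sP, h0]
      simp [hi]
    · field_simp
end

section
/- With the notation of the generator setup, suppose additionally that every projection P_i has rank one (i.e. P_i = |v_i\rangle\langle v_i| for an orthonormal basis (v_i) of V, corresponding to a non-degenerate spectrum of the noise generator) and that K commutes with every P_i. Then the dephased quantum Fisher information vanishes for every unit vector \psi: H_B = 0, i.e. all information about the parameter is lost. -/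
/-- The rank-one operator `|v⟩⟨v| : x ↦ ⟨v, x⟩ v`. -/
noncomputable def ketbra {V : Type*} [NormedAddCommGroup V] [InnerProductSpace ℂ V]
    (v : V) : V →L[ℂ] V :=
  (innerSL ℂ v).smulRight v

/-- In the generator setup, if every projection is rank one,
`P_i = |v_i⟩⟨v_i|` for an orthonormal family `(v_i)` (with `∑_i P_i = 1`,
corresponding to a non-degenerate noise generator), and `K` commutes with every
`P_i`, then the dephased quantum Fisher information vanishes for every unit
vector `ψ`: `H_B = 0`.  (Sums with `p i = 0` contribute `0`, by the convention
`x / 0 = 0`.) -/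
theorem dephased_qfi_eq_zero_of_rank_one_commuting
    {V : Type*} [NormedAddCommGroup V] [InnerProductSpace ℂ V] [FiniteDimensional ℂ V]
    {ι : Type*} [Fintype ι] (P : ι → V →L[ℂ] V)
    (v : ι → V) (hv : Orthonormal ℂ v)
    (hPrank1 : ∀ i, P i = ketbra (v i))
    (hPsum : ∑ i, P i = 1)
    (K : V →L[ℂ] V) (hK : IsSelfAdjoint K)
    (hcomm : ∀ i, K * P i = P i * K)
    (ψ : V) (hψ : ‖ψ‖ = 1)
    (dψ : V) (hdψ : dψ = (-Complex.I) • K ψ)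
    (p : ι → ℝ) (hp : ∀ i, p i = (inner ℂ ψ (P i ψ) : ℂ).re)
    (HB : ℝ)
    (hHB : HB = 4 * (inner ℂ dψ dψ : ℂ).re
        - 4 * ∑ i, (inner ℂ ψ (P i dψ) : ℂ).im ^ 2 / p i) :
    HB = 0 := by
  have hP : ∀ i x, P i x = (inner ℂ (v i) x : ℂ) • v i := by
    intro i x
    rw [hPrank1]
    simp [ketbra]
  have hsym : ∀ x y, (inner ℂ (K x) y : ℂ) = inner ℂ x (K y) := fun x y =>
    (ContinuousLinearMap.isSelfAdjoint_iff_isSymmetric.mp hK) x y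
  have hvv : ∀ i, (inner ℂ (v i) (v i) : ℂ) = 1 := by
    intro i
    rw [inner_self_eq_norm_sq_to_K, hv.1 i]
    simp
  have hKv : ∀ i, ∃ k : ℝ, K (v i) = (k : ℂ) • v i := by
    intro i
    refine ⟨(inner ℂ (v i) (K (v i)) : ℂ).re, ?_⟩
    have h1 := congrArg (fun T : V →L[ℂ] V => T (v i)) (hcomm i)
    simp only [mul_apply_eq_comp, hP, hvv, one_smul] at h1
    have h2 : (((inner ℂ (v i) (K (v i)) : ℂ).re : ℝ) : ℂ) = inner ℂ (v i) (K (v i)) := by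
      apply Complex.conj_eq_iff_re.mp
      rw [inner_conj_symm, hsym]
    rw [h2]
    exact h1
  choose k hk using hKv
  have hd : ∀ i, (inner ℂ (v i) dψ : ℂ) = -Complex.I * ((k i : ℂ) * inner ℂ (v i) ψ) := by
    intro i
    rw [hdψ, inner_smul_right, ← hsym, hk, inner_smul_left, Complex.conj_ofReal]
  have hsum : (inner ℂ dψ dψ : ℂ) = ∑ i, inner ℂ dψ (P i dψ) := by
    have h1 : dψ = ∑ i, P i dψ := by
      have := congrArg (fun T : V →L[ℂ] V => T dψ) hPsum
      simpa using this.symm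
    rw [← inner_sum, ← h1]
  have key : ∀ i, (inner ℂ dψ (P i dψ) : ℂ).re = (inner ℂ ψ (P i dψ) : ℂ).im ^ 2 / p i := by
    intro i
    rw [hp i, hP, hP, inner_smul_right, inner_smul_right, inner_smul_right,
      ← inner_conj_symm dψ, ← inner_conj_symm ψ, hd]
    generalize (inner ℂ (v i) ψ : ℂ) = c
    generalize k i = r
    have e1 : (-Complex.I * ((r : ℂ) * c) * (starRingEnd ℂ) (-Complex.I * ((r : ℂ) * c))).re
        = r ^ 2 * (c.re ^ 2 + c.im ^ 2) := by
      simp; ring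
    have e2 : (-Complex.I * ((r : ℂ) * c) * (starRingEnd ℂ) c).im
        = -(r * (c.re ^ 2 + c.im ^ 2)) := by
      simp; ring
    have e3 : (c * (starRingEnd ℂ) c).re = c.re ^ 2 + c.im ^ 2 := by
      simp; ring
    rw [e1, e2, e3]
    by_cases h : c.re ^ 2 + c.im ^ 2 = 0
    · simp [h]
    · field_simp
  rw [hHB, hsum, Complex.re_sum, Finset.sum_congr rfl (fun i _ => key i)]
  ring
end

section
/- In the qubit-plus-oscillator setup, let c_0, \dots, c_{N-1} be complex numbers with \sum_{n=0}^{N-1} |c_n|^2 = 1, and let \psi_0 := \tfrac{1}{\sqrt{2}}(|0\rangle + |1\rangle) \otimes \sum_{n=0}^{N-1} c_n |n\rangle. Then for every real \lambda, the dephased quantum Fisher information of \psi_\lambda := e^{-iK\lambda}\psi_0 equals H_B = 2 - 2\left( \sum_{n=0}^{N-2} \frac{|c_n|^4}{|c_n|^2 + |c_{n+1}|^2} + |c_{N-1}|^2 \right), where any term with |c_n|^2 + |c_{n+1}|^2 = 0 is taken to be 0. -/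
theorem exp_smul_diag_apply {N : ℕ}
    (K : EuclideanSpace ℂ (Fin 2 × Fin N) →L[ℂ] EuclideanSpace ℂ (Fin 2 × Fin N))
    (hK : ∀ x sn, K x sn = ((sn.1 : ℕ) : ℂ) * x sn) (a : ℂ)
    (x : EuclideanSpace ℂ (Fin 2 × Fin N)) (sn : Fin 2 × Fin N) :
    (NormedSpace.exp (a • K) x) sn = Complex.exp (a * ((sn.1 : ℕ) : ℂ)) * x sn := by
  have hpow : ∀ n : ℕ, ((a • K) ^ n) x sn = (a * ((sn.1 : ℕ) : ℂ)) ^ n * x sn := by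
    intro n
    induction n with
    | zero => simp
    | succ n ih =>
      rw [pow_succ', mul_apply_eq_comp, smul_apply,
        PiLp.smul_apply, hK, ih, smul_eq_mul]
      ring
  have h1 := NormedSpace.exp_series_hasSum_exp' (𝕂 := ℂ) (a • K)
  have h2 := (((EuclideanSpace.proj (𝕜 := ℂ) sn).comp
    (ContinuousLinearMap.apply ℂ (EuclideanSpace ℂ (Fin 2 × Fin N)) x))).hasSum h1
  have h3 := (NormedSpace.exp_series_hasSum_exp' (𝕂 := ℂ) (a * ((sn.1 : ℕ) : ℂ))).mul_right (x sn)
  rw [← Complex.exp_eq_exp_ℂ] at h3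
  have hfun : ∀ n : ℕ, ((EuclideanSpace.proj (𝕜 := ℂ) sn).comp
      (ContinuousLinearMap.apply ℂ (EuclideanSpace ℂ (Fin 2 × Fin N)) x))
        ((n.factorial : ℂ)⁻¹ • (a • K) ^ n)
      = (n.factorial : ℂ)⁻¹ • (a * ((sn.1 : ℕ) : ℂ)) ^ n * x sn := by
    intro n
    change ((n.factorial : ℂ)⁻¹ • (((a • K) ^ n) x)) sn = _
    rw [PiLp.smul_apply, hpow, smul_eq_mul, smul_eq_mul, mul_assoc]
  simp only [hfun] at h2
  exact HasSum.unique h2 h3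

theorem sum_fin_ite (N : ℕ) (f : ℕ → ℝ) (m : ℕ) :
    (∑ n : Fin N, if (n : ℕ) = m then f n else 0) = if m < N then f m else 0 := by
  rw [Fin.sum_univ_eq_sum_range (fun n => if n = m then f n else 0)]
  simp

/-- In the qubit-plus-oscillator setup (modelled on
`ℂ² ⊗ ℂᴺ ≅ EuclideanSpace ℂ (Fin 2 × Fin N)` with basis `|s⟩⊗|n⟩ ↔ (s, n)`), with
qubit number operator `K`, spectral projections `P_m` of the total number operator
onto total number `m`, amplitudes `c₀, …, c_{N-1}` with `∑ |c_n|² = 1`, fiducial state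
`ψ₀ = (1/√2)(|0⟩ + |1⟩) ⊗ ∑ c_n |n⟩` and `ψ_λ = e^{-iKλ}ψ₀`, the dephased quantum
Fisher information equals
`H_B = 2 - 2(∑_{n=0}^{N-2} |c_n|⁴/(|c_n|² + |c_{n+1}|²) + |c_{N-1}|²)`,
where terms with vanishing denominator are `0` (Lean's convention `x / 0 = 0`). -/
theorem dephased_qfi_qubit_oscillator
    (N : ℕ) (hN : 1 ≤ N) (c : ℕ → ℂ)
    (hc : ∑ n ∈ Finset.range N, ‖c n‖ ^ 2 = 1)
    (K : EuclideanSpace ℂ (Fin 2 × Fin N) →L[ℂ] EuclideanSpace ℂ (Fin 2 × Fin N))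
    (hK : ∀ x sn, K x sn = ((sn.1 : ℕ) : ℂ) * x sn)
    (P : Fin (N + 1) →
      EuclideanSpace ℂ (Fin 2 × Fin N) →L[ℂ] EuclideanSpace ℂ (Fin 2 × Fin N))
    (hP : ∀ m x sn, P m x sn = if (sn.1 : ℕ) + (sn.2 : ℕ) = (m : ℕ) then x sn else 0)
    (ψ0 : EuclideanSpace ℂ (Fin 2 × Fin N))
    (hψ0 : ∀ sn, ψ0 sn = ((Real.sqrt 2 : ℝ) : ℂ)⁻¹ * c (sn.2 : ℕ))
    (lam : ℝ) (ψ : EuclideanSpace ℂ (Fin 2 × Fin N))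
    (hψ : ψ = NormedSpace.exp ((-(Complex.I * (lam : ℂ))) • K) ψ0)
    (dψ : EuclideanSpace ℂ (Fin 2 × Fin N)) (hdψ : dψ = (-Complex.I) • K ψ)
    (HB : ℝ)
    (hHB : HB = 4 * (inner ℂ dψ dψ : ℂ).re
        - 4 * ∑ m, (inner ℂ ψ (P m dψ) : ℂ).im ^ 2 / (inner ℂ ψ (P m ψ) : ℂ).re) :
    HB = 2 - 2 * ((∑ n ∈ Finset.range (N - 1),
        ‖c n‖ ^ 4 / (‖c n‖ ^ 2 + ‖c (n + 1)‖ ^ 2))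
      + ‖c (N - 1)‖ ^ 2) := by
  have hn : ∀ sn, ‖ψ sn‖ ^ 2 = ‖c (sn.2 : ℕ)‖ ^ 2 / 2 := by
    intro sn
    have he : ‖Complex.exp (-(Complex.I * (lam : ℂ)) * ((sn.1 : ℕ) : ℂ))‖ = 1 := by
      rw [Complex.norm_exp]; simp
    rw [hψ, exp_smul_diag_apply K hK, hψ0, norm_mul, he, norm_mul, norm_inv, Complex.norm_real,
      Real.norm_eq_abs, one_mul, mul_pow, inv_pow, sq_abs, Real.sq_sqrt (by norm_num)]
    ring
  have hd : ∀ sn, dψ sn = -Complex.I * (((sn.1 : ℕ) : ℂ) * ψ sn) := by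
    intro sn
    rw [hdψ, PiLp.smul_apply, hK, smul_eq_mul]
  have hself : ∀ z : ℂ, z * (starRingEnd ℂ) z = ((‖z‖ ^ 2 : ℝ) : ℂ) := by
    intro z
    rw [Complex.mul_conj, Complex.normSq_eq_norm_sq]
  have h1 : (inner ℂ dψ dψ : ℂ).re = 1 / 2 := by
    rw [PiLp.inner_apply, Complex.re_sum]
    have : ∀ sn : Fin 2 × Fin N, (inner ℂ (dψ sn) (dψ sn) : ℂ).re
        = ((sn.1 : ℕ) : ℝ) ^ 2 * (‖c (sn.2 : ℕ)‖ ^ 2 / 2) := by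
      intro sn
      rw [RCLike.inner_apply, hself, Complex.ofReal_re, hd, norm_mul, norm_mul, mul_pow, mul_pow,
        hn]
      simp
    simp only [this]
    rw [Fintype.sum_prod_type, Fin.sum_univ_two]
    simp only [Fin.val_zero, Fin.val_one, Nat.cast_zero, Nat.cast_one]
    rw [← Finset.mul_sum, ← Finset.mul_sum,
      Fin.sum_univ_eq_sum_range (fun n => ‖c n‖ ^ 2 / 2), ← Finset.sum_div, hc]
    norm_num
  have h2 : ∀ m : Fin (N + 1), (inner ℂ ψ (P m ψ) : ℂ).re
      = (∑ n : Fin N, if (n : ℕ) = (m : ℕ) then ‖c n‖ ^ 2 / 2 else 0)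
        + ∑ n : Fin N, if 1 + (n : ℕ) = (m : ℕ) then ‖c n‖ ^ 2 / 2 else 0 := by
    intro m
    rw [PiLp.inner_apply, Complex.re_sum]
    have : ∀ sn : Fin 2 × Fin N, (inner ℂ (ψ sn) (P m ψ sn) : ℂ).re
        = if (sn.1 : ℕ) + (sn.2 : ℕ) = (m : ℕ) then ‖c (sn.2 : ℕ)‖ ^ 2 / 2 else 0 := by
      intro sn
      rw [RCLike.inner_apply, hP]
      split_ifs
      · rw [hself, Complex.ofReal_re, hn]
      · simp
    simp only [this]
    rw [Fintype.sum_prod_type, Fin.sum_univ_two]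
    simp
  have h3 : ∀ m : Fin (N + 1), (inner ℂ ψ (P m dψ) : ℂ).im
      = - ∑ n : Fin N, if 1 + (n : ℕ) = (m : ℕ) then ‖c n‖ ^ 2 / 2 else 0 := by
    intro m
    rw [PiLp.inner_apply, Complex.im_sum]
    have : ∀ sn : Fin 2 × Fin N, (inner ℂ (ψ sn) (P m dψ sn) : ℂ).im
        = -(((sn.1 : ℕ) : ℝ) * if (sn.1 : ℕ) + (sn.2 : ℕ) = (m : ℕ) then
          ‖c (sn.2 : ℕ)‖ ^ 2 / 2 else 0) := by
      intro sn
      rw [RCLike.inner_apply, hP]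
      split_ifs
      · rw [hd, ← hn]
        have : -Complex.I * (((sn.1 : ℕ) : ℂ) * ψ sn) * (starRingEnd ℂ) (ψ sn)
            = -Complex.I * (((((sn.1 : ℕ) : ℝ) * ‖ψ sn‖ ^ 2 : ℝ)) : ℂ) := by
          rw [Complex.ofReal_mul, ← hself]
          push_cast
          ring
        rw [this, neg_mul, Complex.neg_im, Complex.I_mul_im, Complex.ofReal_re]
      · simp
    simp only [this]
    rw [Fintype.sum_prod_type, Fin.sum_univ_two]
    simp
  obtain ⟨M, rfl⟩ : ∃ M, N = M + 1 := ⟨N - 1, by omega⟩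
  rw [hHB, h1]
  simp only [h2, h3]
  rw [Fin.sum_univ_succ]
  have h0 : (∑ n : Fin (M + 1), if 1 + (n : ℕ) = ((0 : Fin (M + 1 + 1)) : ℕ) then
      ‖c n‖ ^ 2 / 2 else 0) = 0 := by
    apply Finset.sum_eq_zero
    intro n _
    rw [if_neg (by simp)]
  have e1 : ∀ j n : ℕ, (1 + n = j + 1) = (n = j) := by
    intro j n
    apply propext
    omega
  rw [h0]
  simp only [Fin.val_succ, e1]
  have hA := fun m => sum_fin_ite (M + 1) (fun n => ‖c n‖ ^ 2 / 2) m
  simp only [hA]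
  rw [Fin.sum_univ_castSucc]
  simp only [Fin.val_castSucc, Fin.val_last]
  have hB : ∀ j : Fin M, (-(if (j : ℕ) < M + 1 then ‖c j‖ ^ 2 / 2 else 0)) ^ 2
      / ((if (j : ℕ) + 1 < M + 1 then ‖c (j + 1)‖ ^ 2 / 2 else 0)
        + (if (j : ℕ) < M + 1 then ‖c j‖ ^ 2 / 2 else 0))
      = (1 / 2) * (‖c j‖ ^ 4 / (‖c j‖ ^ 2 + ‖c (j + 1)‖ ^ 2)) := by
    intro j
    have := j.2
    rw [if_pos (by omega), if_pos (by omega)]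
    have e : ‖c (j + 1)‖ ^ 2 / 2 + ‖c j‖ ^ 2 / 2 = (‖c j‖ ^ 2 + ‖c (j + 1)‖ ^ 2) / 2 := by ring
    rw [e, div_div_eq_mul_div]
    ring
  simp only [hB]
  rw [← Finset.mul_sum, Fin.sum_univ_eq_sum_range
    (fun j => ‖c j‖ ^ 4 / (‖c j‖ ^ 2 + ‖c (j + 1)‖ ^ 2))]
  rw [if_neg (lt_irrefl _), if_pos (Nat.lt_succ_self M), zero_add]
  have hC : (-(‖c M‖ ^ 2 / 2)) ^ 2 / (‖c M‖ ^ 2 / 2) = ‖c M‖ ^ 2 / 2 := by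
    rw [neg_sq, sq (‖c M‖ ^ 2 / 2), mul_self_div_self]
  rw [hC, Nat.add_sub_cancel]
  simp only [neg_zero, ne_eq, OfNat.ofNat_ne_zero, not_false_eq_true, zero_pow, zero_div]
  ring
end

section
/- In the qubit-plus-oscillator setup, take the uniform superposition amplitudes c_n = 1/\sqrt{N} for n = 0, \dots, N-1 (N \ge 1), i.e. \psi_0 := \tfrac{1}{\sqrt{2}}(|0\rangle + |1\rangle) \otimes \tfrac{1}{\sqrt{N}}\sum_{n=0}^{N-1} |n\rangle. Then for every real \lambda, the dephased quantum Fisher information of \psi_\lambda := e^{-iK\lambda}\psi_0 equals H_B = 1 - 1/N. -/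
theorem aux_exp {N : ℕ}
    (K : EuclideanSpace ℂ (Fin 2 × Fin N) →L[ℂ] EuclideanSpace ℂ (Fin 2 × Fin N))
    (hK : ∀ x sn, K x sn = ((sn.1 : ℕ) : ℂ) * x sn) (c : ℂ)
    (x : EuclideanSpace ℂ (Fin 2 × Fin N)) (sn : Fin 2 × Fin N) :
    NormedSpace.exp (c • K) x sn = Complex.exp (c * ((sn.1 : ℕ) : ℂ)) * x sn := by
  have hpow : ∀ n : ℕ, ((c • K) ^ n) x sn = (c * ((sn.1 : ℕ) : ℂ)) ^ n * x sn := by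
    intro n
    induction n with
    | zero => simp
    | succ k ih =>
      rw [pow_succ', mul_apply_eq_comp]
      have : (c • K) (((c • K) ^ k) x) sn = c * K (((c • K) ^ k) x) sn := by simp
      rw [this, hK, ih]
      ring
  have h1 := NormedSpace.exp_series_hasSum_exp' (𝕂 := ℂ) (c • K)
  have h2 := ((EuclideanSpace.proj sn : EuclideanSpace ℂ (Fin 2 × Fin N) →L[ℂ] ℂ).comp
    (ContinuousLinearMap.apply ℂ (EuclideanSpace ℂ (Fin 2 × Fin N)) x)).hasSum h1
  have h3 := (NormedSpace.exp_series_hasSum_exp' (𝕂 := ℂ) (c * ((sn.1 : ℕ) : ℂ))).mul_right (x sn)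
  rw [Complex.exp_eq_exp_ℂ]
  have h4 : (fun b : ℕ => ((EuclideanSpace.proj sn : EuclideanSpace ℂ (Fin 2 × Fin N) →L[ℂ] ℂ).comp
      (ContinuousLinearMap.apply ℂ (EuclideanSpace ℂ (Fin 2 × Fin N)) x))
        ((b.factorial : ℂ)⁻¹ • (c • K) ^ b))
      = fun i : ℕ => (i.factorial : ℂ)⁻¹ • (c * ((sn.1 : ℕ) : ℂ)) ^ i * x sn := by
    funext n
    rw [map_smul, smul_mul_assoc, ← hpow n]
    rfl
  rw [h4] at h2
  exact HasSum.unique h2 h3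

theorem aux_sum0 {N : ℕ} (m : Fin (N + 1)) (a : ℂ) :
    (∑ n : Fin N, if (n : ℕ) = (m : ℕ) then a else 0) = if (m : ℕ) < N then a else 0 := by
  split_ifs with h
  · rw [Finset.sum_eq_single (⟨m, h⟩ : Fin N)]
    · simp
    · intro b _ hb
      rw [if_neg]
      intro h'
      exact hb (Fin.ext h')
    · simp
  · refine Finset.sum_eq_zero fun n _ => if_neg ?_
    have := n.2
    omega

theorem aux_sum1 {N : ℕ} (m : Fin (N + 1)) (a : ℂ) :
    (∑ n : Fin N, if 1 + (n : ℕ) = (m : ℕ) then a else 0) = if 1 ≤ (m : ℕ) then a else 0 := by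
  split_ifs with h
  · rw [Finset.sum_eq_single (⟨m - 1, by have := m.2; omega⟩ : Fin N)]
    · rw [if_pos]
      show 1 + ((m : ℕ) - 1) = m
      omega
    · intro b _ hb
      rw [if_neg]
      intro h'
      apply hb
      apply Fin.ext
      show (b : ℕ) = m - 1
      omega
    · simp
  · refine Finset.sum_eq_zero fun n _ => if_neg ?_
    omega


/-- In the qubit-plus-oscillator setup (modelled on
`ℂ² ⊗ ℂᴺ ≅ EuclideanSpace ℂ (Fin 2 × Fin N)` with basis `|s⟩⊗|n⟩ ↔ (s, n)`), with
qubit number operator `K`, spectral projections `P_m` of the total number operator,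
uniform-superposition fiducial state
`ψ₀ = (1/√2)(|0⟩ + |1⟩) ⊗ (1/√N)∑_{n<N} |n⟩` and `ψ_λ = e^{-iKλ}ψ₀`, the dephased
quantum Fisher information equals `H_B = 1 - 1/N`.
(Terms of the sum with vanishing denominator are `0`, by the convention
`x / 0 = 0`.) -/
theorem dephased_qfi_qubit_oscillator_uniform
    (N : ℕ) (hN : 1 ≤ N)
    (K : EuclideanSpace ℂ (Fin 2 × Fin N) →L[ℂ] EuclideanSpace ℂ (Fin 2 × Fin N))
    (hK : ∀ x sn, K x sn = ((sn.1 : ℕ) : ℂ) * x sn)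
    (P : Fin (N + 1) →
      EuclideanSpace ℂ (Fin 2 × Fin N) →L[ℂ] EuclideanSpace ℂ (Fin 2 × Fin N))
    (hP : ∀ m x sn, P m x sn = if (sn.1 : ℕ) + (sn.2 : ℕ) = (m : ℕ) then x sn else 0)
    (ψ0 : EuclideanSpace ℂ (Fin 2 × Fin N))
    (hψ0 : ∀ sn : Fin 2 × Fin N,
      ψ0 sn = ((Real.sqrt 2 : ℝ) : ℂ)⁻¹ * ((Real.sqrt N : ℝ) : ℂ)⁻¹)
    (lam : ℝ) (ψ : EuclideanSpace ℂ (Fin 2 × Fin N))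
    (hψ : ψ = NormedSpace.exp ((-(Complex.I * (lam : ℂ))) • K) ψ0)
    (dψ : EuclideanSpace ℂ (Fin 2 × Fin N)) (hdψ : dψ = (-Complex.I) • K ψ)
    (HB : ℝ)
    (hHB : HB = 4 * (inner ℂ dψ dψ : ℂ).re
        - 4 * ∑ m, (inner ℂ ψ (P m dψ) : ℂ).im ^ 2 / (inner ℂ ψ (P m ψ) : ℂ).re) :
    HB = 1 - 1 / N := by
  have hNpos : (0 : ℝ) < N := by exact_mod_cast hN
  have hNC : (N : ℂ) ≠ 0 := by exact_mod_cast hNpos.ne'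
  have hsq : ∀ sn, ψ sn * (starRingEnd ℂ) (ψ sn) = (((2 * N : ℝ)⁻¹ : ℝ) : ℂ) := by
    intro sn
    rw [hψ, aux_exp K hK, hψ0, Complex.mul_conj, Complex.normSq_eq_norm_sq]
    have e : -(Complex.I * (lam : ℂ)) * ((sn.1 : ℕ) : ℂ)
        = ((-(lam * ((sn.1 : ℕ) : ℝ)) : ℝ) : ℂ) * Complex.I := by
      push_cast; ring
    rw [e, norm_mul, Complex.norm_exp_ofReal_mul_I, one_mul, norm_mul, norm_inv, norm_inv,
      Complex.norm_real, Complex.norm_real, Real.norm_eq_abs, Real.norm_eq_abs, mul_pow, inv_pow,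
      inv_pow, sq_abs, sq_abs, Real.sq_sqrt (by norm_num), Real.sq_sqrt hNpos.le, mul_inv]
  have hd : ∀ sn, dψ sn = -Complex.I * (((sn.1 : ℕ) : ℂ) * ψ sn) := by
    intro sn
    rw [hdψ, ← hK]; simp
  have h1 : (inner ℂ dψ dψ : ℂ) = ((1 / 2 : ℝ) : ℂ) := by
    have : ∀ sn, dψ sn * (starRingEnd ℂ) (dψ sn)
        = ((sn.1 : ℕ) : ℂ) ^ 2 * (((2 * N : ℝ)⁻¹ : ℝ) : ℂ) := by
      intro sn
      rw [hd, ← hsq sn]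
      simp only [map_mul, map_neg, Complex.conj_I, map_natCast]
      linear_combination (-((sn.1 : ℕ) : ℂ) ^ 2 * ψ sn * (starRingEnd ℂ) (ψ sn)) * Complex.I_sq
    simp only [PiLp.inner_apply, RCLike.inner_apply, this, Fintype.sum_prod_type,
      Fin.sum_univ_two]
    simp
    field_simp
  have h2 : ∀ m, (inner ℂ ψ (P m dψ) : ℂ)
      = -Complex.I * (if 1 ≤ (m : ℕ) then (((2 * N : ℝ)⁻¹ : ℝ) : ℂ) else 0) := by
    intro m
    have : ∀ sn, P m dψ sn * (starRingEnd ℂ) (ψ sn)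
        = if (sn.1 : ℕ) + (sn.2 : ℕ) = (m : ℕ) then
          -Complex.I * (((sn.1 : ℕ) : ℂ) * (((2 * N : ℝ)⁻¹ : ℝ) : ℂ)) else 0 := by
      intro sn
      rw [hP]
      split_ifs
      · rw [hd, ← hsq sn]; ring
      · simp
    simp only [PiLp.inner_apply, RCLike.inner_apply, this, Fintype.sum_prod_type,
      Fin.sum_univ_two, Fin.val_zero, Fin.val_one, aux_sum1]
    simp
  have h3 : ∀ m, (inner ℂ ψ (P m ψ) : ℂ)
      = (if (m : ℕ) < N then (((2 * N : ℝ)⁻¹ : ℝ) : ℂ) else 0)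
        + (if 1 ≤ (m : ℕ) then (((2 * N : ℝ)⁻¹ : ℝ) : ℂ) else 0) := by
    intro m
    have : ∀ sn, P m ψ sn * (starRingEnd ℂ) (ψ sn)
        = if (sn.1 : ℕ) + (sn.2 : ℕ) = (m : ℕ) then (((2 * N : ℝ)⁻¹ : ℝ) : ℂ) else 0 := by
      intro sn
      rw [hP]
      split_ifs
      · rw [← hsq sn]
      · simp
    simp only [PiLp.inner_apply, RCLike.inner_apply, this, Fintype.sum_prod_type,
      Fin.sum_univ_two, Fin.val_zero, Fin.val_one, aux_sum1, zero_add, aux_sum0]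
  have h4 : ∀ m : Fin (N + 1), (inner ℂ ψ (P m dψ) : ℂ).im ^ 2 / (inner ℂ ψ (P m ψ) : ℂ).re
      = if (m : ℕ) = 0 then 0 else if (m : ℕ) < N then 1 / (4 * N : ℝ) else 1 / (2 * N : ℝ) := by
    intro m
    rw [h2, h3]
    by_cases hm : (m : ℕ) = 0
    · simp [hm]
    · have hm1 : 1 ≤ (m : ℕ) := by omega
      rw [if_pos hm1, if_neg hm, ← Complex.ofReal_zero]
      split_ifs
      · rw [← Complex.ofReal_add, Complex.ofReal_re, neg_mul, Complex.neg_im,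
          Complex.I_mul_im, Complex.ofReal_re]
        field_simp
        norm_num
      · rw [← Complex.ofReal_add, Complex.ofReal_re, neg_mul, Complex.neg_im,
          Complex.I_mul_im, Complex.ofReal_re]
        field_simp
        norm_num
  rw [hHB, h1, Complex.ofReal_re]
  simp only [h4]
  obtain ⟨M, rfl⟩ : ∃ M, N = M + 1 := ⟨N - 1, by omega⟩
  rw [Fin.sum_univ_succ, Fin.sum_univ_castSucc]
  simp
  field_simp
  ring
end

section
/- In the qubit rotation setup, let x, y, z be real numbers with x^2 + y^2 + z^2 = 1, let K := \tfrac{1}{2}(x\sigma_x + y\sigma_y + z\sigma_z), let \psi_\lambda := e^{-iK\lambda}|0\rangle for real \lambda, and take the dephasing projections P_0 := |0\rangle\langle 0| and P_1 := |1\rangle\langle 1| (the spectral projections of G = \tfrac{1}{2}\sigma_z). If \cos^2(\lambda/2) + z^2\sin^2(\lambda/2) \ne 0, then the dephased quantum Fisher information of \psi_\lambda equals H_B = \frac{(1 - z^2)\cos^2(\lambda/2)}{\cos^2(\lambda/2) + z^2 \sin^2(\lambda/2)}. -/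
/-- The continuous linear operator on `ℂ²` associated to a `2 × 2` complex matrix. -/
noncomputable def matOp (A : Matrix (Fin 2) (Fin 2) ℂ) :
    EuclideanSpace ℂ (Fin 2) →L[ℂ] EuclideanSpace ℂ (Fin 2) :=
  LinearMap.toContinuousLinearMap (Matrix.toEuclideanLin A)

lemma exp_apply_eigen {E : Type*} [NormedAddCommGroup E] [NormedSpace ℂ E] [CompleteSpace E]
    (A : E →L[ℂ] E) (μ : ℂ) (v : E) (h : A v = μ • v) :
    NormedSpace.exp A v = Complex.exp μ • v := by
  have h1 := NormedSpace.exp_series_hasSum_exp' (𝕂 := ℂ) A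
  have h2 := h1.mapL (ContinuousLinearMap.apply ℂ E v)
  have h3 := NormedSpace.exp_series_hasSum_exp' (𝕂 := ℂ) μ
  have h4 := h3.smul_const v
  have hp : ∀ n : ℕ, (A ^ n) v = μ ^ n • v := by
    intro n
    induction n with
    | zero => simp
    | succ k ih => rw [pow_succ', mul_apply_eq_comp, ih, map_smul, h, smul_smul, pow_succ]
  have h5 := h2.unique (a₂ := NormedSpace.exp μ • v) (by simpa [hp, smul_smul] using h4)
  rw [Complex.exp_eq_exp_ℂ]
  exact h5

lemma K_apply0 (x y z : ℝ) (u : EuclideanSpace ℂ (Fin 2)) : (((1 : ℂ) / 2) •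
      ((x : ℂ) • matOp !![0, 1; 1, 0]
        + (y : ℂ) • matOp !![0, -Complex.I; Complex.I, 0]
        + (z : ℂ) • matOp !![1, 0; 0, -1])) u 0 = (z * u 0 + (x - Complex.I * y) * u 1) / 2 := by
  simp [matOp, Matrix.toLpLin_apply, Matrix.mulVec, dotProduct, Fin.sum_univ_two]
  ring

lemma K_apply1 (x y z : ℝ) (u : EuclideanSpace ℂ (Fin 2)) : (((1 : ℂ) / 2) •
      ((x : ℂ) • matOp !![0, 1; 1, 0]
        + (y : ℂ) • matOp !![0, -Complex.I; Complex.I, 0]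
        + (z : ℂ) • matOp !![1, 0; 0, -1])) u 1 = ((x + Complex.I * y) * u 0 - z * u 1) / 2 := by
  simp [matOp, Matrix.toLpLin_apply, Matrix.mulVec, dotProduct, Fin.sum_univ_two]
  ring

/-- In the qubit rotation setup, for real `x, y, z` with
`x² + y² + z² = 1`, `K = ½(xσ_x + yσ_y + zσ_z)`, `ψ_λ = e^{-iKλ}|0⟩`, and dephasing
projections `P₀ = |0⟩⟨0|`, `P₁ = |1⟩⟨1|` (the spectral projections of
`G = ½σ_z`): if `cos²(λ/2) + z² sin²(λ/2) ≠ 0`, then the dephased quantum Fisher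
information of `ψ_λ` equals
`H_B = (1 - z²) cos²(λ/2) / (cos²(λ/2) + z² sin²(λ/2))`.
(Terms of the sum with vanishing denominator are `0`, by the convention
`x / 0 = 0`.) -/
theorem qubit_rotation_dephased_qfi
    (x y z : ℝ) (hxyz : x ^ 2 + y ^ 2 + z ^ 2 = 1)
    (K : EuclideanSpace ℂ (Fin 2) →L[ℂ] EuclideanSpace ℂ (Fin 2))
    (hK : K = ((1 : ℂ) / 2) •
      ((x : ℂ) • matOp !![0, 1; 1, 0]
        + (y : ℂ) • matOp !![0, -Complex.I; Complex.I, 0]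
        + (z : ℂ) • matOp !![1, 0; 0, -1]))
    (lam : ℝ) (ψ : EuclideanSpace ℂ (Fin 2))
    (hψ : ψ = NormedSpace.exp ((-(Complex.I * (lam : ℂ))) • K)
      (EuclideanSpace.single 0 1))
    (P : Fin 2 → EuclideanSpace ℂ (Fin 2) →L[ℂ] EuclideanSpace ℂ (Fin 2))
    (hP : ∀ j u i, P j u i = if i = j then u i else 0)
    (dψ : EuclideanSpace ℂ (Fin 2)) (hdψ : dψ = (-Complex.I) • K ψ)
    (HB : ℝ)
    (hHB : HB = 4 * (inner ℂ dψ dψ : ℂ).re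
        - 4 * ∑ j, (inner ℂ ψ (P j dψ) : ℂ).im ^ 2 / (inner ℂ ψ (P j ψ) : ℂ).re)
    (hden : Real.cos (lam / 2) ^ 2 + z ^ 2 * Real.sin (lam / 2) ^ 2 ≠ 0) :
    HB = (1 - z ^ 2) * Real.cos (lam / 2) ^ 2
      / (Real.cos (lam / 2) ^ 2 + z ^ 2 * Real.sin (lam / 2) ^ 2) := by
  have K0 : ∀ u, K u 0 = (z * u 0 + (x - Complex.I * y) * u 1) / 2 := by
    intro u; rw [hK]; exact K_apply0 x y z u
  have K1 : ∀ u, K u 1 = ((x + Complex.I * y) * u 0 - z * u 1) / 2 := by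
    intro u; rw [hK]; exact K_apply1 x y z u
  clear hK
  have hc : (x : ℂ) ^ 2 + y ^ 2 + z ^ 2 = 1 := by exact_mod_cast hxyz
  have hI := Complex.I_sq
  set e : EuclideanSpace ℂ (Fin 2) := EuclideanSpace.single 0 1 with he
  have e0 : e 0 = 1 := by simp [he]
  have e1 : e 1 = 0 := by simp [he]
  have KK : ∀ u, K (K u) = (1 / 4 : ℂ) • u := by
    intro u
    ext i
    fin_cases i
    · simp only [Fin.zero_eta, PiLp.smul_apply, K0, K1, smul_eq_mul]
      linear_combination (u 0 / 4) * hc - (u 0 * y ^ 2 / 4) * hI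
    · simp only [Fin.mk_one, PiLp.smul_apply, K0, K1, smul_eq_mul]
      linear_combination (u 1 / 4) * hc - (u 1 * y ^ 2 / 4) * hI
  have hp := exp_apply_eigen ((-(Complex.I * (lam : ℂ))) • K) (-(lam / 2 : ℂ) * Complex.I)
    ((1 / 2 : ℂ) • e + K e) (by
      simp only [_root_.smul_apply, map_add, map_smul, KK]
      module)
  have hm := exp_apply_eigen ((-(Complex.I * (lam : ℂ))) • K) ((lam / 2 : ℂ) * Complex.I)
    ((1 / 2 : ℂ) • e - K e) (by
      simp only [_root_.smul_apply, map_sub, map_smul, KK]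
      module)
  rw [Complex.exp_mul_I] at hp hm
  rw [Complex.cos_neg, Complex.sin_neg] at hp
  set C : ℝ := Real.cos (lam / 2) with hC
  set S : ℝ := Real.sin (lam / 2) with hS
  have hCc : Complex.cos (lam / 2 : ℂ) = (C : ℂ) := by simp [hC]
  have hSc : Complex.sin (lam / 2 : ℂ) = (S : ℂ) := by simp [hS]
  have hCS : S ^ 2 + C ^ 2 = 1 := Real.sin_sq_add_cos_sq _
  rw [hCc, hSc] at hp hm
  have hpsi : ψ = (C : ℂ) • e - (2 * Complex.I * S) • K e := by
    have : e = ((1 / 2 : ℂ) • e + K e) + ((1 / 2 : ℂ) • e - K e) := by module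
    rw [hψ, this, map_add, hp, hm, ← this]
    module
  have p0 : ψ 0 = C - Complex.I * z * S := by
    rw [hpsi]
    simp only [PiLp.sub_apply, PiLp.smul_apply, K0, e0, e1, smul_eq_mul]
    ring
  have p1 : ψ 1 = (y - Complex.I * x) * S := by
    rw [hpsi]
    simp only [PiLp.sub_apply, PiLp.smul_apply, K1, e0, e1, smul_eq_mul]
    linear_combination (-(y : ℂ) * S) * hI
  have d0 : dψ 0 = (-S - Complex.I * z * C) / 2 := by
    rw [hdψ]
    simp only [PiLp.smul_apply, K0, p0, p1, smul_eq_mul]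
    linear_combination (S / 2 : ℂ) * (z ^ 2 + x ^ 2 + y ^ 2) * hI - (S / 2 : ℂ) * hc
      - (Complex.I * x * y * S / 2) * hI
  have d1 : dψ 1 = (y - Complex.I * x) * C / 2 := by
    rw [hdψ]
    simp only [PiLp.smul_apply, K1, p0, p1, smul_eq_mul]
    linear_combination (-(y : ℂ) * C / 2 + Complex.I * y * z * S / 2) * hI
  have a : (inner ℂ dψ dψ : ℂ).re = 1 / 4 := by
    simp only [PiLp.inner_apply, Fin.sum_univ_two, d0, d1, RCLike.inner_apply]
    have h2 : (starRingEnd ℂ) 2 = 2 := Complex.conj_ofNat 2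
    simp [h2]
    linear_combination hCS / 4 + C ^ 2 * hxyz / 4
  have b0 : (inner ℂ ψ (P 0 dψ) : ℂ).im = -z / 2 := by
    simp [PiLp.inner_apply, Fin.sum_univ_two, hP, p0, d0]
    linear_combination -z * hCS / 2
  have b1 : (inner ℂ ψ (P 1 dψ) : ℂ).im = 0 := by
    simp [PiLp.inner_apply, Fin.sum_univ_two, hP, p1, d1]
    ring
  have c0 : (inner ℂ ψ (P 0 ψ) : ℂ).re = C ^ 2 + z ^ 2 * S ^ 2 := by
    simp [PiLp.inner_apply, Fin.sum_univ_two, hP, p0]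
    ring
  rw [hHB, Fin.sum_univ_two, a, b0, b1, c0]
  field_simp
  linear_combination 4 * z ^ 2 * hCS
end
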